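/- arXiv:2101.10316 — 4 statements merged into one kernel-verified Lean document; each statement's English description precedes it below -/
import Mathlib

section
/- For every integer n ≥ 2, the elements fₙ and gₙ are conjugate in Thompson's group F, and ℓ(fₙ) ≤ 8n − 5 and ℓ(gₙ) ≤ 8n − 5. -/
noncomputable section

open Set

noncomputable section

open Set

def x0fun : ℝ → ℝ := fun t =>
  if t < 0 then t
  else if t ≤ 1/2 then t / 2
  else if t ≤ 3/4 then t - 1/4
  else if t ≤ 1 then 2 * t - 1
  else t

def x0inv : ℝ → ℝ := fun t =>
  if t < 0 then t
  else if t ≤ 1/4 then 2 * t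
  else if t ≤ 1/2 then t + 1/4
  else if t ≤ 1 then (t + 1) / 2
  else t

/-- The generator `x₀` of Thompson's group `F`, as a permutation of `ℝ`
(the identity outside `[0,1]`). -/
def x0 : Equiv.Perm ℝ where
  toFun := x0fun
  invFun := x0inv
  left_inv := by
    intro t
    show x0inv (x0fun t) = t
    unfold x0fun
    split_ifs <;> (unfold x0inv; split_ifs <;> linarith)
  right_inv := by
    intro t
    show x0fun (x0inv t) = t
    unfold x0inv
    split_ifs <;> (unfold x0fun; split_ifs <;> linarith)

def x1fun : ℝ → ℝ := fun t =>
  if t < 0 then t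
  else if t ≤ 1/2 then t
  else if t ≤ 3/4 then t / 2 + 1/4
  else if t ≤ 7/8 then t - 1/8
  else if t ≤ 1 then 2 * t - 1
  else t

def x1inv : ℝ → ℝ := fun t =>
  if t < 0 then t
  else if t ≤ 1/2 then t
  else if t ≤ 5/8 then 2 * t - 1/2
  else if t ≤ 3/4 then t + 1/8
  else if t ≤ 1 then (t + 1) / 2
  else t

set_option maxHeartbeats 2000000 in
/-- The generator `x₁` of Thompson's group `F`, as a permutation of `ℝ`
(the identity outside `[0,1]`). -/
def x1 : Equiv.Perm ℝ where
  toFun := x1fun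
  invFun := x1inv
  left_inv := by
    intro t
    show x1inv (x1fun t) = t
    unfold x1fun
    split_ifs <;> (unfold x1inv; split_ifs <;> linarith)
  right_inv := by
    intro t
    show x1fun (x1inv t) = t
    unfold x1inv
    split_ifs <;> (unfold x1fun; split_ifs <;> linarith)

/-- Thompson's group `F`: the subgroup generated by `x₀` and `x₁`. -/
def ThompsonF : Subgroup (Equiv.Perm ℝ) :=
  Subgroup.closure ({x0, x1} : Set (Equiv.Perm ℝ))

/-- Word length with respect to the generating set `{x₀, x₁}`. -/
def wordLength (f : Equiv.Perm ℝ) : ℕ :=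
  sInf {n | ∃ w : List (Equiv.Perm ℝ), w.length = n ∧
    (∀ g ∈ w, g ∈ ({x0, x1, x0⁻¹, x1⁻¹} : Set (Equiv.Perm ℝ))) ∧ w.prod = f}
/-- The element `fₙ = x₀(x₁⁻¹x₀⁻¹x₁x₀⁻¹)^{n−1} x₁⁻² (x₀x₁x₀x₁⁻¹)^{n−1}` of `F`. -/
def fEl (n : ℕ) : Equiv.Perm ℝ :=
  x0 * (x1⁻¹ * x0⁻¹ * x1 * x0⁻¹) ^ (n - 1) * x1⁻¹ ^ 2 * (x0 * x1 * x0 * x1⁻¹) ^ (n - 1)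

/-- The element `gₙ = x₀(x₁⁻²x₀⁻¹x₁x₀⁻¹)^{n−1} x₁⁻² (x₀x₁x₀)^{n−1}` of `F`. -/
def gEl (n : ℕ) : Equiv.Perm ℝ :=
  x0 * (x1⁻¹ ^ 2 * x0⁻¹ * x1 * x0⁻¹) ^ (n - 1) * x1⁻¹ ^ 2 * (x0 * x1 * x0) ^ (n - 1)


/-- The shift endomorphism `w ↦ x₀⁻¹ w x₀`, sending `xₖ` to `xₖ₊₁` for `k ≥ 1`. -/
def shift : Equiv.Perm ℝ →* Equiv.Perm ℝ := (MulAut.conj x0⁻¹).toMonoidHom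

theorem shift_apply (w : Equiv.Perm ℝ) : shift w = x0⁻¹ * w * x0 := by
  simp [shift]

/-- The permutations that fix every point of `(-∞, 1/2]`. -/
def fixLeftHalf : Subgroup (Equiv.Perm ℝ) where
  carrier := {w | ∀ t ≤ (1 / 2 : ℝ), w t = t}
  one_mem' := fun _ _ => rfl
  mul_mem' := fun {v w} hv hw t ht => by
    rw [Equiv.Perm.mul_apply, hw t ht, hv t ht]
  inv_mem' := fun {w} hw t ht => by
    rw [Equiv.Perm.inv_eq_iff_eq, hw t ht]

theorem x1_mem_fixLeftHalf : x1 ∈ fixLeftHalf := by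
  intro t ht
  show x1fun t = t
  unfold x1fun
  split_ifs <;> linarith

theorem x0_le_half {t : ℝ} (ht : t ≤ 3 / 4) : x0 t ≤ 1 / 2 := by
  show x0fun t ≤ 1 / 2
  unfold x0fun
  split_ifs <;> linarith

theorem shift_apply_of_le {w : Equiv.Perm ℝ} (hw : w ∈ fixLeftHalf) {t : ℝ} (ht : t ≤ 3 / 4) :
    shift w t = t := by
  rw [shift_apply, Equiv.Perm.mul_apply, Equiv.Perm.mul_apply, hw _ (x0_le_half ht)]
  exact x0.symm_apply_apply t

theorem shift_mem_fixLeftHalf {w : Equiv.Perm ℝ} (hw : w ∈ fixLeftHalf) :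
    shift w ∈ fixLeftHalf :=
  fun _ ht => shift_apply_of_le hw (by linarith)

theorem x0_eq_x1_of_ge {t : ℝ} (ht : 7 / 8 ≤ t) : x0 t = x1 t := by
  show x0fun t = x1fun t
  unfold x0fun x1fun
  split_ifs <;> linarith

theorem x1_inv_ge {t : ℝ} (ht : 3 / 4 ≤ t) : 7 / 8 ≤ x1⁻¹ t := by
  show 7 / 8 ≤ x1inv t
  unfold x1inv
  split_ifs <;> linarith

/-- On shifted elements, conjugation by `x₁` agrees with the shift. -/
theorem shift_shift_mul_x1_inv {w : Equiv.Perm ℝ} (hw : w ∈ fixLeftHalf) :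
    shift (shift w) * x1⁻¹ = x1⁻¹ * shift w := by
  have hdisj : (x0 * x1⁻¹).Disjoint (shift w) := by
    intro t
    rcases le_total t (3 / 4) with ht | ht
    · exact Or.inr (shift_apply_of_le hw ht)
    · left
      rw [Equiv.Perm.mul_apply, x0_eq_x1_of_ge (x1_inv_ge ht)]
      exact x1.apply_symm_apply t
  have hcomm : x0 * x1⁻¹ * shift w = shift w * (x0 * x1⁻¹) := hdisj.commute.eq
  rw [shift_apply (shift w), mul_assoc, mul_assoc, ← hcomm]
  group

theorem shift_mul_x1 {w : Equiv.Perm ℝ} (hw : w ∈ fixLeftHalf) :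
    shift w * x1 = x1 * shift (shift w) := by
  have h := shift_shift_mul_x1_inv hw
  rw [mul_inv_eq_iff_eq_mul] at h
  rw [h]
  group

/-- The recursion turning a solution of `σ(h) v = u h` into the next one. -/
theorem shift_mul_eq_mul_step {u v h : Equiv.Perm ℝ} (hu : u ∈ fixLeftHalf)
    (hv : v ∈ fixLeftHalf) (hh : h ∈ fixLeftHalf) (huv : shift h * v = u * h) :
    shift (shift x1 ^ 2 * shift (shift (shift (u * h)))) *
        (x1⁻¹ ^ 2 * shift x1 * shift (shift v) * shift x1) =
      (x1⁻¹ * shift x1 * shift (shift u) * shift x1 * x1⁻¹) *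
        (shift x1 ^ 2 * shift (shift (shift (u * h)))) := by
  have hp : u * h ∈ fixLeftHalf := mul_mem hu hh
  have hpv : shift (u * h) * v = shift u * (u * h) := by
    rw [map_mul, mul_assoc, huv]
  generalize u * h = p at hp hpv ⊢
  have sm := @shift_mem_fixLeftHalf
  have comm₁ : shift (shift x1 ^ 2 * shift (shift (shift p))) * x1⁻¹ =
      x1⁻¹ * (shift x1 ^ 2 * shift (shift (shift p))) := by
    simpa only [map_mul, map_pow] using
      shift_shift_mul_x1_inv (mul_mem (pow_mem x1_mem_fixLeftHalf 2) (sm (sm hp)))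
  have comm₂ : x1⁻¹ * (shift x1 * shift (shift v) * shift x1) =
      shift (shift x1 * shift (shift v) * shift x1) * x1⁻¹ := by
    simpa only [map_mul] using (shift_shift_mul_x1_inv
      (mul_mem (mul_mem x1_mem_fixLeftHalf (sm hv)) x1_mem_fixLeftHalf)).symm
  have pass {w : Equiv.Perm ℝ} (hw : w ∈ fixLeftHalf) :
      shift (shift (shift w)) * shift (shift x1) =
        shift (shift x1) * shift (shift (shift (shift w))) := by
    rw [← map_mul, ← map_mul, shift_mul_x1 hw, map_mul, map_mul]
  have core : shift (shift (shift p)) * shift (shift x1) * shift (shift (shift v)) *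
        shift (shift x1) =
      shift (shift (shift u)) * shift (shift x1) * shift (shift x1) *
        shift (shift (shift (shift p))) := by
    rw [pass hp, pass hu, mul_assoc _ _ (shift (shift x1)), pass hv, ← mul_assoc,
      mul_assoc _ _ (shift (shift x1)), pass (sm hp), mul_assoc _ _ (shift (shift x1)),
      pass (sm hu)]
    simp only [mul_assoc]
    congr 2
    simpa only [map_mul] using congrArg (fun w => shift (shift (shift (shift w)))) hpv
  calc _ = shift (shift x1 ^ 2 * shift (shift (shift p))) * x1⁻¹ *
        (x1⁻¹ * (shift x1 * shift (shift v) * shift x1)) := by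
        simp only [pow_two, mul_assoc]
    _ = x1⁻¹ * shift x1 * shift x1 * (shift (shift (shift p)) * shift (shift x1) *
          shift (shift (shift v)) * shift (shift x1)) * x1⁻¹ := by
        rw [comm₁, comm₂]
        simp only [pow_two, mul_assoc, map_mul]
    _ = x1⁻¹ * shift x1 * (shift x1 * shift (shift (shift u))) * shift (shift x1) *
          shift (shift x1) * shift (shift (shift (shift p))) * x1⁻¹ := by
        rw [core]
        simp only [mul_assoc]
    _ = x1⁻¹ * shift x1 * shift (shift u) * shift x1 *
          (shift (shift x1 ^ 2 * shift (shift (shift p))) * x1⁻¹) := by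
        rw [← map_mul shift x1, ← shift_mul_x1 hu]
        simp only [pow_two, mul_assoc, map_mul]
    _ = _ := by
        rw [comm₁]
        simp only [mul_assoc]

/-- The element `x₀⁻¹ fₘ₊₁`. -/
def fTail (m : ℕ) : Equiv.Perm ℝ :=
  (x1⁻¹ * x0⁻¹ * x1 * x0⁻¹) ^ m * x1⁻¹ ^ 2 * (x0 * x1 * x0 * x1⁻¹) ^ m

/-- The element `x₀⁻¹ gₘ₊₁`. -/
def gTail (m : ℕ) : Equiv.Perm ℝ :=
  (x1⁻¹ ^ 2 * x0⁻¹ * x1 * x0⁻¹) ^ m * x1⁻¹ ^ 2 * (x0 * x1 * x0) ^ m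

theorem fTail_succ (m : ℕ) : fTail (m + 1) =
    x1⁻¹ * shift x1 * shift (shift (fTail m)) * shift x1 * x1⁻¹ := by
  rw [fTail, fTail, pow_succ' (x1⁻¹ * x0⁻¹ * x1 * x0⁻¹), pow_succ (x0 * x1 * x0 * x1⁻¹)]
  simp only [shift_apply]
  generalize (x1⁻¹ * x0⁻¹ * x1 * x0⁻¹) ^ m = p
  generalize (x0 * x1 * x0 * x1⁻¹) ^ m = q
  group

theorem gTail_succ (m : ℕ) : gTail (m + 1) =
    x1⁻¹ ^ 2 * shift x1 * shift (shift (gTail m)) * shift x1 := by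
  rw [gTail, gTail, pow_succ' (x1⁻¹ ^ 2 * x0⁻¹ * x1 * x0⁻¹), pow_succ (x0 * x1 * x0)]
  simp only [shift_apply]
  generalize (x1⁻¹ ^ 2 * x0⁻¹ * x1 * x0⁻¹) ^ m = p
  generalize (x0 * x1 * x0) ^ m = q
  group

theorem fTail_mem_fixLeftHalf (m : ℕ) : fTail m ∈ fixLeftHalf := by
  have hx := x1_mem_fixLeftHalf
  have hs := shift_mem_fixLeftHalf hx
  induction m with
  | zero => simpa [fTail] using inv_mem (pow_mem hx 2)
  | succ m ih =>
    rw [fTail_succ]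
    exact mul_mem (mul_mem (mul_mem (mul_mem (inv_mem hx) hs)
      (shift_mem_fixLeftHalf (shift_mem_fixLeftHalf ih))) hs) (inv_mem hx)

theorem gTail_mem_fixLeftHalf (m : ℕ) : gTail m ∈ fixLeftHalf := by
  have hx := x1_mem_fixLeftHalf
  have hs := shift_mem_fixLeftHalf hx
  induction m with
  | zero => simpa [gTail] using inv_mem (pow_mem hx 2)
  | succ m ih =>
    rw [gTail_succ]
    exact mul_mem (mul_mem (mul_mem (pow_mem (inv_mem hx) 2) hs)
      (shift_mem_fixLeftHalf (shift_mem_fixLeftHalf ih))) hs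

theorem x0_mem_ThompsonF : x0 ∈ ThompsonF := Subgroup.subset_closure (by simp)

theorem x1_mem_ThompsonF : x1 ∈ ThompsonF := Subgroup.subset_closure (by simp)

theorem shift_mem_ThompsonF {w : Equiv.Perm ℝ} (hw : w ∈ ThompsonF) : shift w ∈ ThompsonF := by
  rw [shift_apply]
  exact mul_mem (mul_mem (inv_mem x0_mem_ThompsonF) hw) x0_mem_ThompsonF

theorem fTail_mem_ThompsonF (m : ℕ) : fTail m ∈ ThompsonF := by
  have h0 := x0_mem_ThompsonF
  have h1 := x1_mem_ThompsonF
  exact mul_mem (mul_mem (pow_mem (mul_mem (mul_mem (mul_mem (inv_mem h1) (inv_mem h0)) h1)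
    (inv_mem h0)) _) (pow_mem (inv_mem h1) _))
    (pow_mem (mul_mem (mul_mem (mul_mem h0 h1) h0) (inv_mem h1)) _)

theorem gTail_mem_ThompsonF (m : ℕ) : gTail m ∈ ThompsonF := by
  have h0 := x0_mem_ThompsonF
  have h1 := x1_mem_ThompsonF
  exact mul_mem (mul_mem (pow_mem (mul_mem (mul_mem (mul_mem (pow_mem (inv_mem h1) _)
    (inv_mem h0)) h1) (inv_mem h0)) _) (pow_mem (inv_mem h1) _))
    (pow_mem (mul_mem (mul_mem h0 h1) h0) _)

theorem exists_shift_mul_gTail_eq (m : ℕ) :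
    ∃ h ∈ ThompsonF, h ∈ fixLeftHalf ∧ shift h * gTail m = fTail m * h := by
  induction m with
  | zero => exact ⟨1, one_mem _, one_mem _, by simp [fTail, gTail]⟩
  | succ m ih =>
    obtain ⟨h, hF, hN, heq⟩ := ih
    refine ⟨shift x1 ^ 2 * shift (shift (shift (fTail m * h))), ?_, ?_, ?_⟩
    · exact mul_mem (pow_mem (shift_mem_ThompsonF x1_mem_ThompsonF) 2)
        (shift_mem_ThompsonF (shift_mem_ThompsonF (shift_mem_ThompsonF
          (mul_mem (fTail_mem_ThompsonF m) hF))))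
    · exact mul_mem (pow_mem (shift_mem_fixLeftHalf x1_mem_fixLeftHalf) 2)
        (shift_mem_fixLeftHalf (shift_mem_fixLeftHalf (shift_mem_fixLeftHalf
          (mul_mem (fTail_mem_fixLeftHalf m) hN))))
    · rw [fTail_succ, gTail_succ]
      exact shift_mul_eq_mul_step (fTail_mem_fixLeftHalf m) (gTail_mem_fixLeftHalf m) hN heq

theorem fEl_eq (n : ℕ) : fEl n = x0 * fTail (n - 1) := by
  simp only [fEl, fTail, mul_assoc]

theorem gEl_eq (n : ℕ) : gEl n = x0 * gTail (n - 1) := by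
  simp only [gEl, gTail, mul_assoc]

/-- `f` is a product of `k` generators or inverses of generators. -/
def IsWordProduct (f : Equiv.Perm ℝ) (k : ℕ) : Prop :=
  ∃ w : List (Equiv.Perm ℝ), w.length = k ∧
    (∀ g ∈ w, g ∈ ({x0, x1, x0⁻¹, x1⁻¹} : Set (Equiv.Perm ℝ))) ∧ w.prod = f

namespace IsWordProduct

theorem of_mem {f : Equiv.Perm ℝ} (hf : f ∈ ({x0, x1, x0⁻¹, x1⁻¹} : Set (Equiv.Perm ℝ))) :
    IsWordProduct f 1 :=
  ⟨[f], rfl, by simpa using hf, by simp⟩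

theorem mul {f g : Equiv.Perm ℝ} {k l : ℕ} (hf : IsWordProduct f k) (hg : IsWordProduct g l) :
    IsWordProduct (f * g) (k + l) := by
  obtain ⟨v, rfl, hv, rfl⟩ := hf
  obtain ⟨w, rfl, hw, rfl⟩ := hg
  refine ⟨v ++ w, by simp, fun g hg => ?_, by simp⟩
  exact (List.mem_append.1 hg).elim (hv g) (hw g)

theorem pow {f : Equiv.Perm ℝ} {k : ℕ} (hf : IsWordProduct f k) (m : ℕ) :
    IsWordProduct (f ^ m) (m * k) := by
  induction m with
  | zero => exact ⟨[], by simp, by simp, by simp⟩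
  | succ m ih =>
    rw [pow_succ, Nat.succ_mul]
    exact ih.mul hf

theorem wordLength_le {f : Equiv.Perm ℝ} {k l : ℕ} (hf : IsWordProduct f k) (hkl : k ≤ l) :
    wordLength f ≤ l :=
  (Nat.sInf_le hf).trans hkl

theorem gen_x0 : IsWordProduct x0 1 := of_mem (by simp)

theorem gen_x1 : IsWordProduct x1 1 := of_mem (by simp)

theorem gen_x0_inv : IsWordProduct x0⁻¹ 1 := of_mem (by simp)

theorem gen_x1_inv : IsWordProduct x1⁻¹ 1 := of_mem (by simp)

end IsWordProduct

theorem wordLength_fEl_le {n : ℕ} (hn : 1 ≤ n) : wordLength (fEl n) ≤ 8 * n - 5 := by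
  have h0 := IsWordProduct.gen_x0
  have h1 := IsWordProduct.gen_x1
  have h0' := IsWordProduct.gen_x0_inv
  have h1' := IsWordProduct.gen_x1_inv
  have h := (((h0.mul ((((h1'.mul h0').mul h1).mul h0').pow (n - 1))).mul (h1'.pow 2)).mul
    ((((h0.mul h1).mul h0).mul h1').pow (n - 1)))
  exact h.wordLength_le (by omega)

theorem wordLength_gEl_le {n : ℕ} (hn : 1 ≤ n) : wordLength (gEl n) ≤ 8 * n - 5 := by
  have h0 := IsWordProduct.gen_x0
  have h1 := IsWordProduct.gen_x1
  have h0' := IsWordProduct.gen_x0_inv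
  have h1' := IsWordProduct.gen_x1_inv
  have h := (((h0.mul (((((h1'.pow 2).mul h0').mul h1).mul h0').pow (n - 1))).mul (h1'.pow 2)).mul
    (((h0.mul h1).mul h0).pow (n - 1)))
  exact h.wordLength_le (by omega)

theorem fn_gn_conjugate_with_linear_length (n : ℕ) (hn : 2 ≤ n) :
    fEl n ∈ ThompsonF ∧ gEl n ∈ ThompsonF ∧
    (∃ h ∈ ThompsonF, h⁻¹ * fEl n * h = gEl n) ∧
    wordLength (fEl n) ≤ 8 * n - 5 ∧ wordLength (gEl n) ≤ 8 * n - 5 := by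
  refine ⟨?_, ?_, ?_, wordLength_fEl_le (by omega), wordLength_gEl_le (by omega)⟩
  · rw [fEl_eq]
    exact mul_mem x0_mem_ThompsonF (fTail_mem_ThompsonF _)
  · rw [gEl_eq]
    exact mul_mem x0_mem_ThompsonF (gTail_mem_ThompsonF _)
  · obtain ⟨h, hF, -, heq⟩ := exists_shift_mul_gTail_eq (n - 1)
    refine ⟨h, hF, ?_⟩
    rw [fEl_eq, gEl_eq, mul_assoc, mul_assoc, ← heq, shift_apply]
    group

end
end
end

section
/- For every integer n ≥ 2, the following two identities hold in Thompson's group F, where x_m := x₀^{1−m} x₁ x₀^{m−1} for m ≥ 1: fₙ = x₀ · x₃² x₇² ⋯ x_{4n−5}² · x_{4n−3}^{−2} ⋯ x₅^{−2} x₁^{−2} (ascending indices 4i−1 for i = 1,…,n−1, then descending indices 4i+1 for i = n−1,…,0), and gₙ = x₀ · x₄² x₉² ⋯ x_{5n−6}² · x_{5n−4}^{−2} ⋯ x₆^{−2} x₁^{−2} (ascending indices 5i−1 for i = 1,…,n−1, then descending indices 5i+1 for i = n−1,…,0). -/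
noncomputable section

open Set

noncomputable section

open Set

/-- The standard generators `x_m = x₀^{1−m} x₁ x₀^{m−1}` of `F`, for `m ≥ 1`. -/
def xgen (m : ℕ) : Equiv.Perm ℝ := x0 ^ (1 - (m : ℤ)) * x1 * x0 ^ ((m : ℤ) - 1)


/-- The conjugation relation `x₀⁻¹ x_m x₀ = x_{m+1}`. -/
lemma semiconjBy_x0_xgen (m : ℕ) : SemiconjBy x0 (xgen (m + 1)) (xgen m) := by
  unfold SemiconjBy xgen
  push_cast
  have h₁ : x0 ^ (1 - ((m : ℤ) + 1)) = x0⁻¹ * x0 ^ (1 - (m : ℤ)) := by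
    rw [← zpow_neg_one, ← zpow_add]; congr 1; ring
  have h₂ : x0 ^ ((m : ℤ) + 1 - 1) = x0 ^ ((m : ℤ) - 1) * x0 := by
    rw [← zpow_add_one]; congr 1; ring
  rw [h₁, h₂]
  group

lemma xgen_one : xgen 1 = x1 := by
  simp [xgen]

lemma x0_apply_lt_half {t : ℝ} (ht : t < 3 / 4) : x0 t < 1 / 2 := by
  change x0fun t < 1 / 2
  unfold x0fun
  split_ifs <;> linarith

lemma x1_apply_of_lt_half {t : ℝ} (ht : t < 1 / 2) : x1 t = t := by
  change x1fun t = t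
  unfold x1fun
  split_ifs <;> linarith

lemma xgen_apply_of_lt {m : ℕ} (hm : 2 ≤ m) {t : ℝ} (ht : t < 3 / 4) : xgen m t = t := by
  induction m, hm using Nat.le_induction generalizing t with
  | base =>
    have h := congrArg (fun σ : Equiv.Perm ℝ => σ t) (semiconjBy_x0_xgen 1).eq
    simp only [Equiv.Perm.mul_apply, xgen_one] at h
    rw [x1_apply_of_lt_half (x0_apply_lt_half ht)] at h
    exact x0.injective h
  | succ m _ ih =>
    have h := congrArg (fun σ : Equiv.Perm ℝ => σ t) (semiconjBy_x0_xgen m).eq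
    simp only [Equiv.Perm.mul_apply] at h
    rw [ih ((x0_apply_lt_half ht).trans (by norm_num))] at h
    exact x0.injective h

lemma x0_mul_x1_inv_apply_of_le {t : ℝ} (ht : 3 / 4 ≤ t) : (x0 * x1⁻¹) t = t := by
  change x0fun (x1inv t) = t
  unfold x1inv
  split_ifs <;> (unfold x0fun; split_ifs <;> linarith)

/-- The conjugation relation `x₁⁻¹ x_m x₁ = x_{m+1}` for `m ≥ 2`. -/
lemma semiconjBy_x1_xgen {m : ℕ} (hm : 2 ≤ m) : SemiconjBy x1 (xgen (m + 1)) (xgen m) := by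
  have hd : Equiv.Perm.Disjoint (x0 * x1⁻¹) (xgen m) := fun t => by
    rcases lt_or_ge t (3 / 4) with ht | ht
    · exact Or.inr (xgen_apply_of_lt hm ht)
    · exact Or.inl (x0_mul_x1_inv_apply_of_le ht)
  have hc : SemiconjBy (x0 * x1⁻¹)⁻¹ (xgen m) (xgen m) :=
    SemiconjBy.inv_symm_left hd.commute
  simpa using hc.mul_left (semiconjBy_x0_xgen m)

/-- If `C` conjugates each `y m` to `y (m + d)`, where `C = B * y 1 ^ 2`, and `A * B` is
`y (d - 1) ^ 2 * (y 1)⁻¹ ^ 2`, then `A ^ k * (y 1)⁻¹ ^ 2 * B ^ k` is a product of squares of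
the `y m` with ascending indices and of inverse squares with descending indices. -/
lemma pow_mul_inv_sq_mul_pow_eq_prod {G : Type*} [Group G] (y : ℕ → G) (A B : G) {d : ℕ}
    (hd : 2 ≤ d) (hAB : A * B = y (d - 1) ^ 2 * (y 1)⁻¹ ^ 2)
    (hC : ∀ m, 1 ≤ m → SemiconjBy (B * y 1 ^ 2) (y (m + d)) (y m)) (k : ℕ) :
    A ^ k * (y 1)⁻¹ ^ 2 * B ^ k =
      ((List.range k).map (fun i => y (d * (i + 1) - 1) ^ 2)).prod *
        ((List.range (k + 1)).reverse.map (fun i => (y (d * i + 1))⁻¹ ^ 2)).prod := by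
  induction k with
  | zero => simp
  | succ k ih =>
    set C := B * y 1 ^ 2 with hCdef
    have hconj : ∀ m, 1 ≤ m → MulAut.conj C⁻¹ (y m) = y (m + d) := fun m hm => by
      rw [MulAut.conj_apply, inv_inv, mul_assoc, ← (hC m hm).eq, inv_mul_cancel_left]
    have hasc : ((List.range (k + 1)).map (fun i => y (d * (i + 1) - 1) ^ 2)).prod =
        y (d - 1) ^ 2 * MulAut.conj C⁻¹
          ((List.range k).map (fun i => y (d * (i + 1) - 1) ^ 2)).prod := by
      rw [List.range_succ_eq_map, List.map_cons, List.prod_cons, map_list_prod, List.map_map,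
        List.map_map]
      simp only [zero_add, mul_one]
      congr 3
      funext i
      have hpos : 2 ≤ d * (i + 1) := hd.trans (Nat.le_mul_of_pos_right d i.succ_pos)
      have hidx : d * (i.succ + 1) - 1 = d * (i + 1) - 1 + d := by
        rw [Nat.succ_eq_add_one, mul_add d (i + 1) 1]; omega
      simp only [Function.comp_apply, map_pow]
      rw [hconj _ (by omega), hidx]
    have hdesc : ((List.range (k + 1 + 1)).reverse.map (fun i => (y (d * i + 1))⁻¹ ^ 2)).prod =
        MulAut.conj C⁻¹
          ((List.range (k + 1)).reverse.map (fun i => (y (d * i + 1))⁻¹ ^ 2)).prod *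
          (y 1)⁻¹ ^ 2 := by
      rw [List.range_succ_eq_map (n := k + 1), List.reverse_cons, List.map_append,
        List.prod_append, ← List.map_reverse, map_list_prod, List.map_map, List.map_map]
      simp only [List.map_cons, List.map_nil, List.prod_singleton, mul_zero, zero_add]
      congr 3
      funext i
      simp only [Function.comp_apply, map_pow]
      rw [map_inv (MulAut.conj C⁻¹), hconj _ (by omega), Nat.succ_eq_add_one, mul_add, mul_one, add_right_comm]
    calc A ^ (k + 1) * (y 1)⁻¹ ^ 2 * B ^ (k + 1)
        = A * B * (B⁻¹ * (A ^ k * (y 1)⁻¹ ^ 2 * B ^ k) * B) := by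
          rw [pow_succ' A, pow_succ B]; group
      _ = y (d - 1) ^ 2 * MulAut.conj C⁻¹ (A ^ k * (y 1)⁻¹ ^ 2 * B ^ k) * (y 1)⁻¹ ^ 2 := by
          rw [hAB, MulAut.conj_apply, hCdef]; group
      _ = _ := by
          rw [ih, hasc, hdesc, map_mul]; simp only [mul_assoc]

theorem fn_gn_normal_forms (n : ℕ) (hn : 2 ≤ n) :
    fEl n = x0 * ((List.range (n - 1)).map (fun i => xgen (4 * (i + 1) - 1) ^ 2)).prod *
      ((List.range n).reverse.map (fun i => (xgen (4 * i + 1))⁻¹ ^ 2)).prod ∧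
    gEl n = x0 * ((List.range (n - 1)).map (fun i => xgen (5 * (i + 1) - 1) ^ 2)).prod *
      ((List.range n).reverse.map (fun i => (xgen (5 * i + 1))⁻¹ ^ 2)).prod := by
  obtain ⟨k, rfl⟩ : ∃ k, n = k + 1 := ⟨n - 1, by omega⟩
  have hx1_two : SemiconjBy x1⁻¹ (xgen 2) (xgen 3) :=
    (semiconjBy_x1_xgen le_rfl).inv_symm_left
  have hx1_three : SemiconjBy x1⁻¹ (xgen 3) (xgen 4) :=
    (semiconjBy_x1_xgen (by norm_num)).inv_symm_left
  have hx0_sq : x0⁻¹ * x1 ^ 2 = xgen 2 ^ 2 * x0⁻¹ := by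
    have h := (semiconjBy_x0_xgen 1).inv_symm_left.pow_right 2
    rw [xgen_one] at h
    exact h.eq
  have hx1_sq : ∀ m, 2 ≤ m → SemiconjBy (x1 ^ 2) (xgen (m + 2)) (xgen m) := fun m hm => by
    rw [pow_two]
    exact (semiconjBy_x1_xgen hm).mul_left (semiconjBy_x1_xgen (by omega))
  have hB : ∀ m, 1 ≤ m → SemiconjBy (x0 * x1 * x0) (xgen (m + 3)) (xgen m) := fun m hm =>
    ((semiconjBy_x0_xgen m).mul_left (semiconjBy_x1_xgen (by omega))).mul_left
      (semiconjBy_x0_xgen (m + 2))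
  simp only [fEl, gEl, Nat.add_sub_cancel]
  constructor
  · have h := pow_mul_inv_sq_mul_pow_eq_prod xgen (x1⁻¹ * x0⁻¹ * x1 * x0⁻¹)
      (x0 * x1 * x0 * x1⁻¹) (d := 4) (by norm_num) ?_ ?_ k
    · rw [xgen_one] at h
      simp only [mul_assoc] at h ⊢
      rw [h]
    · calc x1⁻¹ * x0⁻¹ * x1 * x0⁻¹ * (x0 * x1 * x0 * x1⁻¹)
          = x1⁻¹ * (x0⁻¹ * x1 ^ 2) * x0 * x1⁻¹ := by rw [pow_two x1]; group
        _ = x1⁻¹ * xgen 2 ^ 2 * x1⁻¹ := by rw [hx0_sq]; group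
        _ = xgen 3 ^ 2 * (xgen 1)⁻¹ ^ 2 := by
          rw [(hx1_two.pow_right 2).eq, xgen_one]; group
    · intro m hm
      rw [xgen_one]
      exact ((hB m hm).mul_left
        (semiconjBy_x1_xgen (by omega : 2 ≤ m + 2)).inv_symm_left).mul_left
          (hx1_sq (m + 2) (by omega))
  · have h := pow_mul_inv_sq_mul_pow_eq_prod xgen (x1⁻¹ ^ 2 * x0⁻¹ * x1 * x0⁻¹)
      (x0 * x1 * x0) (d := 5) (by norm_num) ?_ ?_ k
    · rw [xgen_one] at h
      simp only [mul_assoc] at h ⊢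
      rw [h]
    · calc x1⁻¹ ^ 2 * x0⁻¹ * x1 * x0⁻¹ * (x0 * x1 * x0)
          = x1⁻¹ ^ 2 * (x0⁻¹ * x1 ^ 2) * x0 := by rw [pow_two x1]; group
        _ = x1⁻¹ * x1⁻¹ * xgen 2 ^ 2 := by rw [hx0_sq]; group
        _ = xgen 4 ^ 2 * (xgen 1)⁻¹ ^ 2 := by
          rw [((hx1_three.mul_left hx1_two).pow_right 2).eq, xgen_one, pow_two x1⁻¹]
    · intro m hm
      rw [xgen_one]
      exact (hB m hm).mul_left (hx1_sq (m + 3) (by omega))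

end
end
end

section
/- For every integer n ≥ 3, ℓ(fₙ) = ℓ(gₙ) = 8n − 5. -/
noncomputable section

open Set

noncomputable section

open Set

/-! ### Values of the generators on their affine pieces -/

theorem x0_of_le_half {t : ℝ} (h0 : 0 ≤ t) (h1 : t ≤ 1 / 2) : x0 t = t / 2 := by
  show x0fun t = _
  unfold x0fun
  split_ifs <;> linarith

theorem x0_of_mid {t : ℝ} (h0 : 1 / 2 ≤ t) (h1 : t ≤ 3 / 4) : x0 t = t - 1 / 4 := by
  show x0fun t = _
  unfold x0fun
  split_ifs <;> linarith

theorem x0_of_ge {t : ℝ} (h0 : 3 / 4 ≤ t) (h1 : t ≤ 1) : x0 t = 2 * t - 1 := by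
  show x0fun t = _
  unfold x0fun
  split_ifs <;> linarith

theorem x0_inv_of_le {t : ℝ} (h0 : 0 ≤ t) (h1 : t ≤ 1 / 4) : x0⁻¹ t = 2 * t := by
  show x0inv t = _
  unfold x0inv
  split_ifs <;> linarith

theorem x0_inv_of_mid {t : ℝ} (h0 : 1 / 4 ≤ t) (h1 : t ≤ 1 / 2) : x0⁻¹ t = t + 1 / 4 := by
  show x0inv t = _
  unfold x0inv
  split_ifs <;> linarith

theorem x0_inv_of_ge {t : ℝ} (h0 : 1 / 2 ≤ t) (h1 : t ≤ 1) : x0⁻¹ t = (t + 1) / 2 := by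
  show x0inv t = _
  unfold x0inv
  split_ifs <;> linarith

theorem x1_of_le_half {t : ℝ} (h1 : t ≤ 1 / 2) : x1 t = t := by
  show x1fun t = _
  unfold x1fun
  split_ifs <;> linarith

theorem x1_of_mid {t : ℝ} (h0 : 1 / 2 ≤ t) (h1 : t ≤ 3 / 4) : x1 t = t / 2 + 1 / 4 := by
  show x1fun t = _
  unfold x1fun
  split_ifs <;> linarith

theorem x1_of_mid_right {t : ℝ} (h0 : 3 / 4 ≤ t) (h1 : t ≤ 7 / 8) : x1 t = t - 1 / 8 := by
  show x1fun t = _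
  unfold x1fun
  split_ifs <;> linarith

theorem x1_of_ge {t : ℝ} (h0 : 7 / 8 ≤ t) (h1 : t ≤ 1) : x1 t = 2 * t - 1 := by
  show x1fun t = _
  unfold x1fun
  split_ifs <;> linarith

theorem x1_inv_of_le_half {t : ℝ} (h1 : t ≤ 1 / 2) : x1⁻¹ t = t := by
  show x1inv t = _
  unfold x1inv
  split_ifs <;> linarith

theorem x1_inv_of_mid {t : ℝ} (h0 : 1 / 2 ≤ t) (h1 : t ≤ 5 / 8) :
    x1⁻¹ t = 2 * t - 1 / 2 := by
  show x1inv t = _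
  unfold x1inv
  split_ifs <;> linarith

theorem x1_inv_of_mid_right {t : ℝ} (h0 : 5 / 8 ≤ t) (h1 : t ≤ 3 / 4) :
    x1⁻¹ t = t + 1 / 8 := by
  show x1inv t = _
  unfold x1inv
  split_ifs <;> linarith

theorem x1_inv_of_ge {t : ℝ} (h0 : 3 / 4 ≤ t) (h1 : t ≤ 1) : x1⁻¹ t = (t + 1) / 2 := by
  show x1inv t = _
  unfold x1inv
  split_ifs <;> linarith

/-- The set of the generators and their inverses. -/
def generators : Set (Equiv.Perm ℝ) := {x0, x1, x0⁻¹, x1⁻¹}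

theorem inv_mem_generators {s : Equiv.Perm ℝ} (hs : s ∈ generators) : s⁻¹ ∈ generators := by
  rcases hs with rfl | rfl | rfl | rfl <;> simp [generators]

/-! ### The contraction towards `1` -/

/-- The `m`-th iterate of the contraction `u ↦ (u + 1) / 2`. -/
def sh (m : ℕ) (u : ℝ) : ℝ := 1 - (1 - u) / 2 ^ m

@[simp] theorem sh_zero (u : ℝ) : sh 0 u = u := by simp [sh]

theorem sh_add (m n : ℕ) (u : ℝ) : sh (m + n) u = sh m (sh n u) := by
  simp only [sh, pow_add]
  field_simp
  ring

theorem sh_succ_half (m : ℕ) : sh (m + 1) (1 / 2) = sh m (3 / 4) := by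
  rw [sh_add]; norm_num [sh]

theorem sh_strictMono (m : ℕ) : StrictMono (sh m) := by
  intro a b hab
  have : (1 - b) / 2 ^ m < (1 - a) / 2 ^ m := by gcongr
  unfold sh; linarith

theorem sh_le_one (m : ℕ) {u : ℝ} (hu : u ≤ 1) : sh m u ≤ 1 := by
  have : 0 ≤ (1 - u) / 2 ^ m := div_nonneg (by linarith) (by positivity)
  unfold sh; linarith

theorem le_sh (m : ℕ) {u : ℝ} (hu : u ≤ 1) : u ≤ sh m u := by
  have : (1 - u) / 2 ^ m ≤ 1 - u := div_le_self (by linarith) (one_le_pow₀ (by norm_num))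
  unfold sh; linarith

theorem two_mul_sh_sub_one (m : ℕ) (u : ℝ) : 2 * sh m u - 1 = sh m (2 * u - 1) := by
  unfold sh; ring

theorem three_quarters_le_sh_succ (d : ℕ) {u : ℝ} (h0 : 1 / 2 ≤ u) (h1 : u ≤ 1) :
    3 / 4 ≤ sh (d + 1) u := by
  have := le_sh d h1
  rw [add_comm, sh_add]
  unfold sh at *
  linarith

theorem sh_eq_sh_iff {m n : ℕ} {a b : ℝ} (ha : 1 / 2 ≤ a) (ha' : a < 3 / 4)
    (hb : 1 / 2 ≤ b) (hb' : b < 3 / 4) : sh m a = sh n b ↔ m = n ∧ a = b := by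
  refine ⟨fun h => ?_, by rintro ⟨rfl, rfl⟩; rfl⟩
  have key : ∀ {m n : ℕ} {a b : ℝ}, a < 3 / 4 → 1 / 2 ≤ b → b < 3 / 4 → m ≤ n →
      sh m a = sh n b → m = n ∧ a = b := by
    intro m n a b ha' hb hb' hmn h
    obtain ⟨d, rfl⟩ := Nat.exists_eq_add_of_le hmn
    rw [sh_add] at h
    have h := (sh_strictMono m).injective h
    cases d with
    | zero => simpa using h
    | succ d =>
      have := three_quarters_le_sh_succ d hb (by linarith)
      linarith
  rcases le_total m n with hmn | hmn
  · exact key ha' hb hb' hmn h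
  · obtain ⟨h1, h2⟩ := key hb' ha ha' hmn h.symm
    exact ⟨h1.symm, h2.symm⟩

/-! ### Two marked sets and how the generators move them -/

/-- The points `2⁻¹, 2⁻², …`. -/
def leftMarks : Set ℝ := {v | ∃ k : ℕ, v = 1 / 2 ^ (k + 1)}

/-- The points `2⁻ᵏ` and `1 - 2⁻ᵏ` for `k ≥ 1`: the orbit of `1/2` under `x₀`. -/
def marks : Set ℝ := {v | v ∈ leftMarks ∨ ∃ k : ℕ, v = sh k (1 / 2)}

theorem half_mem_leftMarks : (1 / 2 : ℝ) ∈ leftMarks := ⟨0, by norm_num⟩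

theorem pos_of_mem_leftMarks {v : ℝ} (hv : v ∈ leftMarks) : 0 < v := by
  obtain ⟨k, rfl⟩ := hv; positivity

theorem le_half_of_mem_leftMarks {v : ℝ} (hv : v ∈ leftMarks) : v ≤ 1 / 2 := by
  obtain ⟨k, rfl⟩ := hv
  have : (1 : ℝ) ≤ 2 ^ k := one_le_pow₀ (by norm_num)
  rw [pow_succ, div_le_div_iff₀ (by positivity) (by norm_num)]
  linarith

theorem sh_half_mem_marks (m : ℕ) : sh m (1 / 2) ∈ marks := Or.inr ⟨m, rfl⟩

theorem sh_not_mem_marks (m : ℕ) {c : ℝ} (h0 : 1 / 2 < c) (h1 : c < 3 / 4) :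
    sh m c ∉ marks := by
  rintro (h | ⟨k, h⟩)
  · have := le_half_of_mem_leftMarks h
    have := le_sh m (u := c) (by linarith)
    linarith
  · rw [sh_eq_sh_iff h0.le h1 le_rfl (by norm_num)] at h
    linarith [h.2]

theorem x0_mem_leftMarks {v : ℝ} (hv : v ∈ leftMarks) : x0 v ∈ leftMarks := by
  rw [x0_of_le_half (pos_of_mem_leftMarks hv).le (le_half_of_mem_leftMarks hv)]
  obtain ⟨k, rfl⟩ := hv
  exact ⟨k + 1, by rw [pow_succ 2 (k + 1)]; field_simp⟩

theorem x0_inv_mem_leftMarks {v : ℝ} (hv : v ∈ leftMarks) (h : v ≠ 1 / 2) :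
    x0⁻¹ v ∈ leftMarks := by
  obtain ⟨k, rfl⟩ := hv
  cases k with
  | zero => norm_num at h
  | succ k =>
    have h2 : (1 : ℝ) / 2 ^ (k + 1) ≤ 1 / 2 := le_half_of_mem_leftMarks ⟨k, rfl⟩
    have h3 : (1 : ℝ) / 2 ^ (k + 1 + 1) = 1 / 2 ^ (k + 1) / 2 := by
      rw [pow_succ 2 (k + 1)]; field_simp
    rw [x0_inv_of_le (by positivity) (by linarith)]
    exact ⟨k, by linarith⟩

theorem x0_mem_marks {v : ℝ} (hv : v ∈ marks) : x0 v ∈ marks := by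
  rcases hv with hv | ⟨k, rfl⟩
  · exact Or.inl (x0_mem_leftMarks hv)
  · cases k with
    | zero => rw [sh_zero]; exact Or.inl (x0_mem_leftMarks half_mem_leftMarks)
    | succ k =>
      rw [x0_of_ge (three_quarters_le_sh_succ k le_rfl (by norm_num))
        (sh_le_one _ (by norm_num)), sh_succ_half, two_mul_sh_sub_one]
      exact Or.inr ⟨k, by norm_num⟩

theorem half_add_one_sh (k : ℕ) : (sh k (1 / 2) + 1) / 2 = sh (k + 1) (1 / 2) := by
  rw [sh_succ_half]; unfold sh; ring

theorem x0_inv_mem_marks {v : ℝ} (hv : v ∈ marks) : x0⁻¹ v ∈ marks := by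
  have right : ∀ k : ℕ, x0⁻¹ (sh k (1 / 2)) ∈ marks := fun k => by
    rw [x0_inv_of_ge (le_sh k (by norm_num)) (sh_le_one k (by norm_num)), half_add_one_sh]
    exact sh_half_mem_marks _
  rcases hv with hv | ⟨k, rfl⟩
  · by_cases h : v = 1 / 2
    · simpa [h] using right 0
    · exact Or.inl (x0_inv_mem_leftMarks hv h)
  · exact right k

theorem x1_mem_marks {v : ℝ} (hv : v ∈ marks) (h : v ≠ 3 / 4) : x1 v ∈ marks := by
  rcases hv with hv | ⟨k, rfl⟩
  · rw [x1_of_le_half (le_half_of_mem_leftMarks hv)]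
    exact Or.inl hv
  · match k with
    | 0 =>
      rw [x1_of_le_half (by simp)]
      exact sh_half_mem_marks _
    | 1 => norm_num [sh] at h
    | k + 2 =>
      have h1 := three_quarters_le_sh_succ k (u := 1 / 2) le_rfl (by norm_num)
      have h2 := half_add_one_sh (k + 1)
      rw [x1_of_ge (by linarith) (sh_le_one _ (by norm_num)), ← h2]
      exact Or.inr ⟨k + 1, by ring⟩

theorem x1_inv_mem_marks {v : ℝ} (hv : v ∈ marks) : x1⁻¹ v ∈ marks := by
  rcases hv with hv | ⟨k, rfl⟩
  · rw [x1_inv_of_le_half (le_half_of_mem_leftMarks hv)]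
    exact Or.inl hv
  · cases k with
    | zero =>
      rw [x1_inv_of_le_half (by simp)]
      exact sh_half_mem_marks _
    | succ k =>
      rw [x1_inv_of_ge (three_quarters_le_sh_succ k le_rfl (by norm_num))
        (sh_le_one _ (by norm_num)), half_add_one_sh]
      exact sh_half_mem_marks _

theorem x1_mem_leftMarks_iff (v : ℝ) : x1 v ∈ leftMarks ↔ v ∈ leftMarks := by
  constructor
  · intro h
    have h' := x1_inv_of_le_half (le_half_of_mem_leftMarks h)
    have h'' : v = x1 v := by simpa using h'
    rwa [← h''] at h
  · intro h
    rwa [x1_of_le_half (le_half_of_mem_leftMarks h)]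

/-- A generator changes the membership of at most one point in one of the two marked sets,
and of no point in the other. -/
theorem generator_marks {s : Equiv.Perm ℝ} (hs : s ∈ generators) :
    ((∃ a, ∀ v, v ≠ a → (s v ∈ marks ↔ v ∈ marks)) ∧ ∀ v, (s v ∈ leftMarks ↔ v ∈ leftMarks)) ∨
    ((∀ v, (s v ∈ marks ↔ v ∈ marks)) ∧
      ∃ a, ∀ v, v ≠ a → (s v ∈ leftMarks ↔ v ∈ leftMarks)) := by
  rcases hs with rfl | rfl | rfl | rfl
  · refine Or.inr ⟨fun v => ⟨fun h => by simpa using x0_inv_mem_marks h, x0_mem_marks⟩,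
      x0⁻¹ (1 / 2), fun v hv => ⟨fun h => ?_, x0_mem_leftMarks⟩⟩
    simpa using x0_inv_mem_leftMarks h (fun h' => hv (by rw [← h']; simp))
  · refine Or.inl ⟨⟨3 / 4, fun v hv => ⟨fun h => by simpa using x1_inv_mem_marks h,
      fun h => x1_mem_marks h hv⟩⟩, x1_mem_leftMarks_iff⟩
  · refine Or.inr ⟨fun v => ⟨fun h => by simpa using x0_mem_marks h, x0_inv_mem_marks⟩,
      1 / 2, fun v hv => ⟨fun h => by simpa using x0_mem_leftMarks h,
        fun h => x0_inv_mem_leftMarks h hv⟩⟩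
  · refine Or.inl ⟨⟨x1 (3 / 4), fun v hv => ⟨fun h => ?_, x1_inv_mem_marks⟩⟩, fun v => ?_⟩
    · simpa using x1_mem_marks h (fun h' => hv (by rw [← h']; simp))
    · simpa using (x1_mem_leftMarks_iff (x1⁻¹ v)).symm

/-! ### Counting the changes along a word -/

open Classical in
/-- The number of times the trajectory of `y` under the word `w` (read from the right)
enters or leaves `P`. -/
def changes (P : Set ℝ) : List (Equiv.Perm ℝ) → ℝ → ℕ
  | [], _ => 0
  | s :: w, y => (if s (w.prod y) ∈ P ↔ w.prod y ∈ P then 0 else 1) + changes P w y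

open Classical in
theorem sum_change_le_one {ι : Type*} [Fintype ι] {a : ι → ℝ} (ha : Function.Injective a)
    (P : Set ℝ) (s g : Equiv.Perm ℝ) {v₀ : ℝ} (h : ∀ v, v ≠ v₀ → (s v ∈ P ↔ v ∈ P)) :
    ∑ i, (if s (g (a i)) ∈ P ↔ g (a i) ∈ P then 0 else 1) ≤ 1 := by
  rw [Finset.sum_ite, Finset.sum_const_zero, zero_add, Finset.sum_const, smul_eq_mul, mul_one,
    Finset.card_le_one]
  intro i hi j hj
  have eq : ∀ i, ¬ (s (g (a i)) ∈ P ↔ g (a i) ∈ P) → g (a i) = v₀ :=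
    fun i hi => by_contra fun hne => hi (h _ hne)
  simp only [Finset.mem_filter, Finset.mem_univ, true_and] at hi hj
  exact ha (g.injective ((eq i hi).trans (eq j hj).symm))

theorem sum_changes_le_length {ι κ : Type*} [Fintype ι] [Fintype κ] {a : ι → ℝ} {b : κ → ℝ}
    (ha : Function.Injective a) (hb : Function.Injective b) {w : List (Equiv.Perm ℝ)}
    (hw : ∀ s ∈ w, s ∈ generators) :
    ∑ i, changes marks w (a i) + ∑ i, changes leftMarks w (b i) ≤ w.length := by
  induction w with
  | nil => simp [changes]
  | cons s w ih =>
    have ih := ih fun t ht => hw t (List.mem_cons_of_mem _ ht)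
    simp only [changes, Finset.sum_add_distrib, List.length_cons]
    rcases generator_marks (hw s List.mem_cons_self) with ⟨⟨v₀, h⟩, h'⟩ | ⟨h', v₀, h⟩
    · have := sum_change_le_one ha marks s w.prod h
      simp only [h', if_true, Finset.sum_const_zero]
      omega
    · have := sum_change_le_one hb leftMarks s w.prod h
      simp only [h', if_true, Finset.sum_const_zero]
      omega

theorem one_le_changes {P : Set ℝ} {w : List (Equiv.Perm ℝ)} {y : ℝ}
    (h : ¬ (w.prod y ∈ P ↔ y ∈ P)) : 1 ≤ changes P w y := by
  induction w with
  | nil => simp at h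
  | cons s w ih =>
    rw [List.prod_cons, Equiv.Perm.mul_apply] at h
    rw [changes]
    split_ifs with hs
    · have := ih (by rwa [← hs])
      omega
    · omega

theorem two_le_changes {P : Set ℝ} {w w' : List (Equiv.Perm ℝ)} {y : ℝ} (hw : w' <:+ w)
    (hy : y ∉ P) (hmid : w'.prod y ∈ P) (hend : w.prod y ∉ P) : 2 ≤ changes P w y := by
  induction w with
  | nil =>
    rw [List.suffix_nil] at hw
    subst hw
    exact absurd hmid hend
  | cons s w ih =>
    rcases List.suffix_cons_iff.mp hw with rfl | hw
    · exact absurd hmid hend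
    · rw [List.prod_cons, Equiv.Perm.mul_apply] at hend
      rw [changes]
      split_ifs with hs
      · have := ih hw (by rwa [← hs])
        omega
      · have : w.prod y ∈ P := by tauto
        have := one_le_changes (P := P) (w := w) (y := y) (by tauto)
        omega

/-! ### Standard dyadic intervals -/

/-- `u` and `v` are the endpoints of a standard dyadic interval in the interior of `[0,1]`. -/
def IsStd (u v : ℝ) : Prop :=
  ∃ k j : ℕ, 0 < j ∧ j + 1 < 2 ^ k ∧ u * 2 ^ k = j ∧ v * 2 ^ k = j + 1

theorem IsStd.exists_four_mul {u v : ℝ} (h : IsStd u v) :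
    ∃ k j : ℕ, 0 < j ∧ j + 1 < 4 * 2 ^ k ∧ u * (4 * 2 ^ k) = j ∧ v * (4 * 2 ^ k) = j + 1 := by
  obtain ⟨k, j, h0, h1, hu, hv⟩ := h
  match k with
  | 0 => omega
  | 1 => omega
  | k + 2 =>
    have e : (2 : ℝ) ^ (k + 2) = 4 * 2 ^ k := by ring
    rw [e] at hu hv
    exact ⟨k, j, h0, by rw [pow_add] at h1; omega, hu, hv⟩

theorem isStd_sh_half_five_eighths (m : ℕ) : IsStd (sh m (1 / 2)) (sh m (5 / 8)) := by
  have h := Nat.one_le_two_pow (n := m)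
  refine ⟨m + 3, 2 ^ (m + 3) - 4, ?_, ?_, ?_, ?_⟩
  · rw [pow_add]; omega
  · rw [pow_add]; omega
  all_goals
    rw [Nat.cast_sub (by rw [pow_add]; omega)]
    push_cast
    simp only [sh, pow_add]
    field_simp
    ring

theorem isStd_sh_half_succ (m : ℕ) : IsStd (sh m (1 / 2)) (sh (m + 1) (1 / 2)) := by
  have h := Nat.one_le_two_pow (n := m)
  rw [sh_succ_half]
  refine ⟨m + 2, 2 ^ (m + 2) - 2, ?_, ?_, ?_, ?_⟩
  · rw [pow_add]; omega
  · rw [pow_add]; omega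
  all_goals
    rw [Nat.cast_sub (by rw [pow_add]; omega)]
    push_cast
    simp only [sh, pow_add]
    field_simp
    ring

theorem not_isStd_of_sh_half_between {u v : ℝ} (m : ℕ) (hu : u < sh m (1 / 2))
    (hv : sh m (1 / 2) < v) : ¬ IsStd u v := by
  rintro ⟨k, j, h0, h1, hju, hjv⟩
  have hs : sh m (1 / 2) * 2 ^ (m + 1) = 2 ^ (m + 1) - 1 := by
    simp only [sh, pow_succ]
    field_simp
    ring
  have hu' : u * 2 ^ k < sh m (1 / 2) * 2 ^ k := by gcongr
  have hv' : sh m (1 / 2) * 2 ^ k < v * 2 ^ k := by gcongr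
  rw [hju] at hu'
  rw [hjv] at hv'
  rcases le_total k (m + 1) with hk | hk
  · obtain ⟨d, hd⟩ := Nat.exists_eq_add_of_le hk
    rw [hd, pow_add] at hs
    have h1' : ((j : ℝ) + 1) + 1 ≤ 2 ^ k := by exact_mod_cast h1
    have hd1 : (1 : ℝ) ≤ 2 ^ d := one_le_pow₀ (by norm_num)
    have : (sh m (1 / 2) * 2 ^ k) * 2 ^ d < (2 ^ k - 1) * 2 ^ d := by
      gcongr
      linarith
    nlinarith
  · obtain ⟨d, rfl⟩ := Nat.exists_eq_add_of_le hk
    have e : sh m (1 / 2) * 2 ^ (m + 1 + d) = (((2 ^ (m + 1) - 1) * 2 ^ d : ℤ) : ℝ) := by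
      rw [pow_add, ← mul_assoc, hs]
      push_cast
      ring
    rw [e] at hu' hv'
    have h2 : (j : ℤ) < (2 ^ (m + 1) - 1) * 2 ^ d := by exact_mod_cast hu'
    have h3 : (2 ^ (m + 1) - 1) * 2 ^ d < (j : ℤ) + 1 := by exact_mod_cast hv'
    omega

theorem IsStd.of_affine {u v c e : ℝ} {j k i l : ℕ} (hu : u * (4 * 2 ^ k) = j)
    (hv : v * (4 * 2 ^ k) = j + 1) (h0 : 0 < i) (h1 : i + 1 < 2 ^ l)
    (hc : c * 2 ^ l = 4 * 2 ^ k) (he : (i : ℝ) = j + e * 2 ^ l) :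
    IsStd (c * u + e) (c * v + e) :=
  ⟨l, i, h0, h1, by linear_combination hu + u * hc - he, by linear_combination hv + v * hc - he⟩

theorem IsStd.apply_x0 {u v : ℝ} (h : IsStd u v) : IsStd (x0 u) (x0 v) := by
  obtain ⟨k, j, h0, h1, hu, hv⟩ := h.exists_four_mul
  have hN : (0 : ℝ) < 2 ^ k := by positivity
  have h0' : (0 : ℝ) < j := by exact_mod_cast h0
  have h1' : (j : ℝ) + 1 < 4 * 2 ^ k := by exact_mod_cast h1
  rcases (by omega : j + 1 ≤ 2 * 2 ^ k ∨ (2 * 2 ^ k ≤ j ∧ j + 1 ≤ 3 * 2 ^ k) ∨ 3 * 2 ^ k ≤ j)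
    with c | ⟨c, d⟩ | c
  · have c' : (j : ℝ) + 1 ≤ 2 * 2 ^ k := by exact_mod_cast c
    rw [x0_of_le_half (by nlinarith) (by nlinarith), x0_of_le_half (by nlinarith) (by nlinarith)]
    convert IsStd.of_affine (c := 1 / 2) (e := 0) (i := j) (l := k + 3) hu hv h0
      (by rw [pow_add]; omega) (by ring) (by ring) using 1 <;> ring
  · have c' : 2 * (2 : ℝ) ^ k ≤ j := by exact_mod_cast c
    have d' : (j : ℝ) + 1 ≤ 3 * 2 ^ k := by exact_mod_cast d
    rw [x0_of_mid (by nlinarith) (by nlinarith), x0_of_mid (by nlinarith) (by nlinarith)]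
    convert IsStd.of_affine (c := 1) (e := -1 / 4) (i := j - 2 ^ k) (l := k + 2) hu hv (by omega)
      (by rw [pow_add]; omega) (by ring)
      (by rw [Nat.cast_sub (by omega)]; push_cast; ring) using 1 <;> ring
  · have c' : 3 * (2 : ℝ) ^ k ≤ j := by exact_mod_cast c
    rw [x0_of_ge (by nlinarith) (by nlinarith), x0_of_ge (by nlinarith) (by nlinarith)]
    convert IsStd.of_affine (c := 2) (e := -1) (i := j - 2 * 2 ^ k) (l := k + 1) hu hv (by omega)
      (by rw [pow_add]; omega) (by ring)
      (by rw [Nat.cast_sub (by omega)]; push_cast; ring) using 1 <;> ring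

theorem IsStd.apply_x0_inv {u v : ℝ} (h : IsStd u v) : IsStd (x0⁻¹ u) (x0⁻¹ v) := by
  obtain ⟨k, j, h0, h1, hu, hv⟩ := h.exists_four_mul
  have hN : (0 : ℝ) < 2 ^ k := by positivity
  have h0' : (0 : ℝ) < j := by exact_mod_cast h0
  have h1' : (j : ℝ) + 1 < 4 * 2 ^ k := by exact_mod_cast h1
  rcases (by omega : j + 1 ≤ 2 ^ k ∨ (2 ^ k ≤ j ∧ j + 1 ≤ 2 * 2 ^ k) ∨ 2 * 2 ^ k ≤ j)
    with c | ⟨c, d⟩ | c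
  · have c' : (j : ℝ) + 1 ≤ 2 ^ k := by exact_mod_cast c
    rw [x0_inv_of_le (by nlinarith) (by nlinarith), x0_inv_of_le (by nlinarith) (by nlinarith)]
    convert IsStd.of_affine (c := 2) (e := 0) (i := j) (l := k + 1) hu hv h0
      (by rw [pow_add]; omega) (by ring) (by ring) using 1 <;> ring
  · have c' : (2 : ℝ) ^ k ≤ j := by exact_mod_cast c
    have d' : (j : ℝ) + 1 ≤ 2 * 2 ^ k := by exact_mod_cast d
    rw [x0_inv_of_mid (by nlinarith) (by nlinarith), x0_inv_of_mid (by nlinarith) (by nlinarith)]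
    convert IsStd.of_affine (c := 1) (e := 1 / 4) (i := j + 2 ^ k) (l := k + 2) hu hv (by omega)
      (by rw [pow_add]; omega) (by ring) (by push_cast; ring) using 1 <;> ring
  · have c' : 2 * (2 : ℝ) ^ k ≤ j := by exact_mod_cast c
    rw [x0_inv_of_ge (by nlinarith) (by nlinarith), x0_inv_of_ge (by nlinarith) (by nlinarith)]
    convert IsStd.of_affine (c := 1 / 2) (e := 1 / 2) (i := j + 4 * 2 ^ k) (l := k + 3) hu hv
      (by omega) (by rw [pow_add]; omega) (by ring) (by push_cast; ring) using 1 <;> ring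

theorem IsStd.apply_x1 {u v : ℝ} (h : IsStd u v) : IsStd (x1 u) (x1 v) := by
  obtain ⟨k, j, h0, h1, hu, hv⟩ := h.exists_four_mul
  have hN : (0 : ℝ) < 2 ^ k := by positivity
  have h1' : (j : ℝ) + 1 < 4 * 2 ^ k := by exact_mod_cast h1
  rcases (by omega : j + 1 ≤ 2 * 2 ^ k ∨ (2 * 2 ^ k ≤ j ∧ j + 1 ≤ 3 * 2 ^ k) ∨ 3 * 2 ^ k ≤ j)
    with c | ⟨c, d⟩ | c
  · have c' : (j : ℝ) + 1 ≤ 2 * 2 ^ k := by exact_mod_cast c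
    rwa [x1_of_le_half (by nlinarith), x1_of_le_half (by nlinarith)]
  · have c' : 2 * (2 : ℝ) ^ k ≤ j := by exact_mod_cast c
    have d' : (j : ℝ) + 1 ≤ 3 * 2 ^ k := by exact_mod_cast d
    rw [x1_of_mid (by nlinarith) (by nlinarith), x1_of_mid (by nlinarith) (by nlinarith)]
    convert IsStd.of_affine (c := 1 / 2) (e := 1 / 4) (i := j + 2 * 2 ^ k) (l := k + 3) hu hv
      (by omega) (by rw [pow_add]; omega) (by ring) (by push_cast; ring) using 1 <;> ring
  · have c' : 3 * (2 : ℝ) ^ k ≤ j := by exact_mod_cast c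
    cases k with
    | zero => omega
    | succ k =>
      have hN : (0 : ℝ) < 2 ^ k := by positivity
      rw [pow_succ] at c h1
      rw [pow_succ] at c' h1'
      rcases (by omega : j + 1 ≤ 7 * 2 ^ k ∨ 7 * 2 ^ k ≤ j) with d | d
      · have d' : (j : ℝ) + 1 ≤ 7 * 2 ^ k := by exact_mod_cast d
        rw [x1_of_mid_right (by rw [pow_succ] at hu; nlinarith) (by rw [pow_succ] at hu; nlinarith),
          x1_of_mid_right (by rw [pow_succ] at hv; nlinarith) (by rw [pow_succ] at hv; nlinarith)]
        convert IsStd.of_affine (c := 1) (e := -1 / 8) (i := j - 2 ^ k) (l := k + 3) hu hv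
          (by omega) (by rw [pow_add]; omega) (by ring)
          (by rw [Nat.cast_sub (by omega)]; push_cast; ring) using 1 <;> ring
      · have d' : 7 * (2 : ℝ) ^ k ≤ j := by exact_mod_cast d
        rw [x1_of_ge (by rw [pow_succ] at hu; nlinarith) (by rw [pow_succ] at hu; nlinarith),
          x1_of_ge (by rw [pow_succ] at hv; nlinarith) (by rw [pow_succ] at hv; nlinarith)]
        convert IsStd.of_affine (c := 2) (e := -1) (i := j - 4 * 2 ^ k) (l := k + 2) hu hv
          (by omega) (by rw [pow_add]; omega) (by ring)
          (by rw [Nat.cast_sub (by omega)]; push_cast; ring) using 1 <;> ring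

theorem IsStd.apply_x1_inv {u v : ℝ} (h : IsStd u v) (hne : u ≠ 1 / 2) :
    IsStd (x1⁻¹ u) (x1⁻¹ v) := by
  obtain ⟨k, j, h0, h1, hu, hv⟩ := h.exists_four_mul
  have hN : (0 : ℝ) < 2 ^ k := by positivity
  have h1' : (j : ℝ) + 1 < 4 * 2 ^ k := by exact_mod_cast h1
  have hj : j ≠ 2 * 2 ^ k := by
    rintro rfl
    push_cast at hu
    exact hne (by nlinarith)
  rcases (by omega : j + 1 ≤ 2 * 2 ^ k ∨ 2 * 2 ^ k + 1 ≤ j) with c | c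
  · have c' : (j : ℝ) + 1 ≤ 2 * 2 ^ k := by exact_mod_cast c
    rwa [x1_inv_of_le_half (by nlinarith), x1_inv_of_le_half (by nlinarith)]
  · have c' : 2 * (2 : ℝ) ^ k + 1 ≤ j := by exact_mod_cast c
    cases k with
    | zero => omega
    | succ k =>
      have hN : (0 : ℝ) < 2 ^ k := by positivity
      rw [pow_succ] at c h1
      rw [pow_succ] at c' h1'
      rcases (by omega : j + 1 ≤ 5 * 2 ^ k ∨ (5 * 2 ^ k ≤ j ∧ j + 1 ≤ 6 * 2 ^ k) ∨ 6 * 2 ^ k ≤ j)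
        with d | ⟨d, e⟩ | d
      · have d' : (j : ℝ) + 1 ≤ 5 * 2 ^ k := by exact_mod_cast d
        rw [x1_inv_of_mid (by rw [pow_succ] at hu; nlinarith) (by rw [pow_succ] at hu; nlinarith),
          x1_inv_of_mid (by rw [pow_succ] at hv; nlinarith) (by rw [pow_succ] at hv; nlinarith)]
        convert IsStd.of_affine (c := 2) (e := -1 / 2) (i := j - 2 * 2 ^ k) (l := k + 2) hu hv
          (by omega) (by rw [pow_add]; omega) (by ring)
          (by rw [Nat.cast_sub (by omega)]; push_cast; ring) using 1 <;> ring
      · have d' : 5 * (2 : ℝ) ^ k ≤ j := by exact_mod_cast d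
        have e' : (j : ℝ) + 1 ≤ 6 * 2 ^ k := by exact_mod_cast e
        rw [x1_inv_of_mid_right (by rw [pow_succ] at hu; nlinarith)
            (by rw [pow_succ] at hu; nlinarith),
          x1_inv_of_mid_right (by rw [pow_succ] at hv; nlinarith)
            (by rw [pow_succ] at hv; nlinarith)]
        convert IsStd.of_affine (c := 1) (e := 1 / 8) (i := j + 2 ^ k) (l := k + 3) hu hv
          (by omega) (by rw [pow_add]; omega) (by ring) (by push_cast; ring) using 1 <;> ring
      · have d' : 6 * (2 : ℝ) ^ k ≤ j := by exact_mod_cast d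
        rw [x1_inv_of_ge (by rw [pow_succ] at hu; nlinarith) (by rw [pow_succ] at hu; nlinarith),
          x1_inv_of_ge (by rw [pow_succ] at hv; nlinarith) (by rw [pow_succ] at hv; nlinarith)]
        convert IsStd.of_affine (c := 1 / 2) (e := 1 / 2) (i := j + 8 * 2 ^ k) (l := k + 4) hu hv
          (by omega) (by rw [pow_add]; omega) (by ring) (by push_cast; ring) using 1 <;> ring

theorem IsStd.apply_generator {u v : ℝ} (h : IsStd u v) (hne : u ≠ 1 / 2)
    {s : Equiv.Perm ℝ} (hs : s ∈ generators) : IsStd (s u) (s v) := by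
  rcases hs with rfl | rfl | rfl | rfl
  exacts [h.apply_x0, h.apply_x1, h.apply_x0_inv, h.apply_x1_inv hne]

/-- If a word maps a standard interval to a nonstandard one, the left endpoint passes
through `1/2`. -/
theorem exists_suffix_of_not_isStd_image {w : List (Equiv.Perm ℝ)}
    (hw : ∀ s ∈ w, s ∈ generators) {y z : ℝ} (h : IsStd y z)
    (h' : ¬ IsStd (w.prod y) (w.prod z)) : ∃ w', w' <:+ w ∧ w'.prod y = 1 / 2 := by
  induction w with
  | nil => exact absurd h h'
  | cons s w ih =>
    by_cases hst : IsStd (w.prod y) (w.prod z)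
    · refine ⟨w, List.suffix_cons s w, by_contra fun hne => h' ?_⟩
      exact hst.apply_generator hne (hw s List.mem_cons_self)
    · obtain ⟨w', hw', e⟩ := ih (fun t ht => hw t (List.mem_cons_of_mem _ ht)) hst
      exact ⟨w', hw'.trans (List.suffix_cons s w), e⟩

/-- If a word maps a nonstandard interval to a standard one, the left endpoint passes
through `1/2`. -/
theorem exists_suffix_of_not_isStd {w : List (Equiv.Perm ℝ)}
    (hw : ∀ s ∈ w, s ∈ generators) {y z : ℝ} (h : ¬ IsStd y z)
    (h' : IsStd (w.prod y) (w.prod z)) : ∃ w', w' <:+ w ∧ w'.prod y = 1 / 2 := by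
  induction w with
  | nil => exact absurd h' h
  | cons s w ih =>
    by_cases hst : IsStd (w.prod y) (w.prod z)
    · obtain ⟨w', hw', e⟩ := ih (fun t ht => hw t (List.mem_cons_of_mem _ ht)) hst
      exact ⟨w', hw'.trans (List.suffix_cons s w), e⟩
    · refine ⟨s :: w, List.suffix_rfl, by_contra fun hne => hst ?_⟩
      simpa using h'.apply_generator hne (inv_mem_generators (hw s List.mem_cons_self))

/-! ### The lower bound -/

theorem length_lower_bound {f : Equiv.Perm ℝ} {q k : ℕ} (hq : 1 ≤ q) {η : ℕ → ℝ}
    (hβ : ∀ j ≤ k, f (sh ((q + 1) * j) (9 / 16)) = sh ((q + 1) * j) (1 / 2))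
    (hγ : ∀ j ≤ k, f (sh ((q + 1) * j) (5 / 8)) = sh ((q + 1) * j + 1) (1 / 2))
    (hδ : ∀ j < k, f (sh ((q + 1) * j + q) (1 / 2)) = sh ((q + 1) * j + q) (9 / 16))
    (hα : ∀ j < k, f (sh ((q + 1) * (j + 1)) (1 / 2)) = sh ((q + 1) * j + q) (5 / 8))
    (hη : ∀ j < k, f (η j) = sh ((q + 1) * j + q) (1 / 2))
    (hη_gt : ∀ j < k, 1 / 2 < η j) (hη_lt : ∀ j < k, η j < sh ((q + 1) * (j + 1)) (1 / 2))
    {w : List (Equiv.Perm ℝ)} (hw : ∀ s ∈ w, s ∈ generators) (hf : w.prod = f) :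
    8 * k + 3 ≤ w.length := by
  subst hf
  let a : (Fin (k + 1) ⊕ Fin (k + 1)) ⊕ (Fin k ⊕ Fin k) → ℝ :=
    Sum.elim
      (Sum.elim (fun j => sh ((q + 1) * j) (9 / 16)) (fun j => sh ((q + 1) * j) (5 / 8)))
      (Sum.elim (fun j => sh ((q + 1) * j + q) (1 / 2))
        (fun j => sh ((q + 1) * (j + 1)) (1 / 2)))
  let b : Unit ⊕ (Fin k ⊕ Fin k) → ℝ :=
    Sum.elim (fun _ => sh ((q + 1) * 0) (9 / 16))
      (Sum.elim (fun j => sh ((q + 1) * (j + 1)) (1 / 2)) (fun j => η j))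
  have val : ∀ {m n : ℕ} {c d : ℝ}, 1 / 2 ≤ c → c < 3 / 4 → 1 / 2 ≤ d → d < 3 / 4 →
      ¬ (m = n ∧ c = d) → sh m c ≠ sh n d :=
    fun h1 h2 h3 h4 h => mt (sh_eq_sh_iff h1 h2 h3 h4).mp h
  have idx : ∀ {m n : ℕ} {c : ℝ}, 1 / 2 ≤ c → c < 3 / 4 → sh m c = sh n c → m = n :=
    fun h1 h2 h => ((sh_eq_sh_iff h1 h2 h1 h2).mp h).1
  have cancel : ∀ {i j : ℕ}, (q + 1) * i = (q + 1) * j → i = j :=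
    fun h => Nat.eq_of_mul_eq_mul_left (Nat.succ_pos q) h
  have offset : ∀ i j : ℕ, (q + 1) * i + q ≠ (q + 1) * j := by
    intro i j h
    have := congrArg (· % (q + 1)) h
    simp only [Nat.mul_add_mod, Nat.mul_mod_right] at this
    rw [Nat.mod_eq_of_lt (Nat.lt_succ_self q)] at this
    omega
  have ha : Function.Injective a := by
    refine Function.Injective.sumElim
      (Function.Injective.sumElim (fun i j h => ?_) (fun i j h => ?_) fun i j => ?_)
      (Function.Injective.sumElim (fun i j h => ?_) (fun i j h => ?_) fun i j => ?_) ?_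
    · exact Fin.ext (cancel (idx (by norm_num) (by norm_num) h))
    · exact Fin.ext (cancel (idx (by norm_num) (by norm_num) h))
    · exact val (by norm_num) (by norm_num) (by norm_num) (by norm_num) (by norm_num)
    · exact Fin.ext (cancel (Nat.add_right_cancel (idx (by norm_num) (by norm_num) h)))
    · have := cancel (idx (by norm_num) (by norm_num) h)
      exact Fin.ext (by omega)
    · exact val (by norm_num) (by norm_num) (by norm_num) (by norm_num)
        (fun h => offset _ _ h.1)
    · rintro (i | i) (j | j) <;>
        exact val (by norm_num) (by norm_num) (by norm_num) (by norm_num) (by norm_num)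
  have hb : Function.Injective b := by
    refine Function.Injective.sumElim (fun _ _ _ => rfl)
      (Function.Injective.sumElim (fun i j h => ?_) (fun i j h => ?_) fun i j h => ?_) ?_
    · have := cancel (idx (by norm_num) (by norm_num) h)
      exact Fin.ext (by omega)
    · have h := congrArg w.prod h
      rw [hη _ i.2, hη _ j.2] at h
      exact Fin.ext (cancel (Nat.add_right_cancel (idx (by norm_num) (by norm_num) h)))
    · have h := congrArg w.prod h
      rw [hα _ i.2, hη _ j.2] at h
      exact val (by norm_num) (by norm_num) (by norm_num) (by norm_num) (by norm_num) h
    · rintro _ (j | j) h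
      · exact val (by norm_num) (by norm_num) (by norm_num) (by norm_num) (by norm_num) h
      · have h := congrArg w.prod h
        simp only [Sum.elim_inr] at h
        rw [hβ 0 (Nat.zero_le k), hη _ j.2] at h
        exact val (by norm_num) (by norm_num) (by norm_num) (by norm_num)
          (fun h => offset j 0 h.1.symm) h
  have hsum := sum_changes_le_length ha hb hw
  have hmarks : ∀ i, 1 ≤ changes marks w (a i) := by
    have half := sh_half_mem_marks
    have h9 : ∀ m, sh m (9 / 16) ∉ marks :=
      fun m => sh_not_mem_marks m (by norm_num) (by norm_num)
    have h5 : ∀ m, sh m (5 / 8) ∉ marks :=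
      fun m => sh_not_mem_marks m (by norm_num) (by norm_num)
    rintro ((j | j) | (j | j)) <;> apply one_le_changes <;>
      simp only [a, Sum.elim_inl, Sum.elim_inr]
    · rw [hβ j (by omega)]
      exact fun h => h9 _ (h.mp (half _))
    · rw [hγ j (by omega)]
      exact fun h => h5 _ (h.mp (half _))
    · rw [hδ j j.2]
      exact fun h => h9 _ (h.mpr (half _))
    · rw [hα j j.2]
      exact fun h => h5 _ (h.mpr (half _))
  have hnot : ∀ {v : ℝ}, 1 / 2 < v → v ∉ leftMarks :=
    fun hv h => absurd (le_half_of_mem_leftMarks h) (not_le.mpr hv)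
  have sh_gt : ∀ (m : ℕ) {c : ℝ}, 1 / 2 < c → c ≤ 1 → 1 / 2 < sh m c :=
    fun m c h h1 => h.trans_le (le_sh m h1)
  have sh_half_gt : ∀ m : ℕ, 1 ≤ m → 1 / 2 < sh m (1 / 2) := by
    intro m hm
    obtain ⟨m, rfl⟩ := Nat.exists_eq_add_of_le' hm
    rw [sh_succ_half]
    exact sh_gt m (by norm_num) (by norm_num)
  have hzero : 1 ≤ changes leftMarks w (b (Sum.inl ())) := by
    apply one_le_changes
    simp only [b, Sum.elim_inl]
    rw [hβ 0 (Nat.zero_le k)]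
    intro h
    refine hnot (sh_gt _ (by norm_num) (by norm_num)) (h.mp ?_)
    simpa using half_mem_leftMarks
  have hleft : ∀ i, 2 ≤ changes leftMarks w (b (Sum.inr i)) := by
    rintro (j | j) <;> simp only [b, Sum.elim_inl, Sum.elim_inr]
    · obtain ⟨w', hw', e⟩ := exists_suffix_of_not_isStd_image hw
        (isStd_sh_half_five_eighths ((q + 1) * (j + 1))) (by
          rw [hα j j.2, hγ _ (by omega), sh_succ_half]
          refine not_isStd_of_sh_half_between ((q + 1) * (j + 1)) ?_
            (sh_strictMono _ (by norm_num))
          rw [show (q + 1) * ((j : ℕ) + 1) = (q + 1) * j + q + 1 by ring, sh_succ_half]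
          exact sh_strictMono _ (by norm_num))
      refine two_le_changes hw' (hnot (sh_half_gt _ ?_)) (by rw [e]; exact half_mem_leftMarks) ?_
      · exact Nat.mul_pos (Nat.succ_pos q) (Nat.succ_pos _)
      · rw [hα j j.2]
        exact hnot (sh_gt _ (by norm_num) (by norm_num))
    · obtain ⟨w', hw', e⟩ := exists_suffix_of_not_isStd hw
        (not_isStd_of_sh_half_between (v := sh ((q + 1) * (j + 1)) (9 / 16)) _ (hη_lt j j.2)
          (sh_strictMono _ (by norm_num))) (by
          rw [hη j j.2, hβ _ (by omega),
            show (q + 1) * ((j : ℕ) + 1) = (q + 1) * j + q + 1 by ring]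
          exact isStd_sh_half_succ _)
      refine two_le_changes hw' (hnot (hη_gt j j.2)) (by rw [e]; exact half_mem_leftMarks) ?_
      rw [hη j j.2]
      exact hnot (sh_half_gt _ (by omega))
  have s1 : 4 * k + 2 ≤ ∑ i, changes marks w (a i) := by
    have := Finset.card_nsmul_le_sum Finset.univ _ 1 fun i _ => hmarks i
    simp only [Finset.card_univ, Fintype.card_sum, Fintype.card_fin, smul_eq_mul] at this
    omega
  have s2 : 4 * k + 1 ≤ ∑ i, changes leftMarks w (b i) := by
    rw [Fintype.sum_sum_type]
    have := Finset.card_nsmul_le_sum Finset.univ _ 2 fun i _ => hleft i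
    simp only [Finset.card_univ, Fintype.card_sum, Fintype.card_fin, smul_eq_mul] at this
    rw [Finset.univ_unique, Finset.sum_singleton]
    exact (by omega : 4 * k + 1 ≤ 1 + (k + k) * 2).trans (Nat.add_le_add hzero this)
  omega

/-! ### Values of the two families of elements -/

section Conjugation

variable {A U c : Equiv.Perm ℝ}

theorem conj_pow_succ_apply (k : ℕ) (t : ℝ) :
    (A ^ (k + 1) * c * U ^ (k + 1)) t = A ((A ^ k * c * U ^ k) (U t)) := by
  rw [pow_succ' A, pow_succ U]; rfl

theorem conj_pow_apply_of_le_half (hc : ∀ t ≤ 1 / 2, c t = t)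
    (hU : ∀ t, 0 ≤ t → t ≤ 1 / 2 → 0 ≤ U t ∧ U t ≤ 1 / 2 ∧ A (U t) = t) (k : ℕ) {t : ℝ}
    (h0 : 0 ≤ t) (h1 : t ≤ 1 / 2) : (A ^ k * c * U ^ k) t = t := by
  induction k generalizing t with
  | zero => simpa using hc t h1
  | succ k ih =>
    obtain ⟨h2, h3, h4⟩ := hU t h0 h1
    rw [conj_pow_succ_apply, ih h2 h3, h4]

theorem conj_pow_apply_sh {p : ℕ} (hc : ∀ t ≤ 1 / 2, c t = t)
    (hU : ∀ t, 0 ≤ t → t ≤ 1 / 2 → 0 ≤ U t ∧ U t ≤ 1 / 2 ∧ A (U t) = t)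
    (hU' : ∀ t, 1 / 2 ≤ t → t ≤ 1 → U (sh p t) = t)
    (hA : ∀ t, 3 / 4 ≤ t → t ≤ 1 → A t = sh p t) {a b : ℝ} (ha : 1 / 2 ≤ a) (ha' : a ≤ 1)
    (hb : 3 / 4 ≤ b) (hb' : b ≤ 1) (hUa : 0 ≤ U a) (hUa' : U a ≤ 1 / 2) (hAU : A (U a) = b)
    {j k : ℕ} (hjk : j ≤ k) (hab : j = k → c a = b) :
    (A ^ k * c * U ^ k) (sh (p * j) a) = sh (p * j) b := by
  induction k generalizing j with
  | zero =>
    obtain rfl : j = 0 := by omega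
    simpa using hab rfl
  | succ k ih =>
    rw [conj_pow_succ_apply]
    cases j with
    | zero =>
      rw [Nat.mul_zero, sh_zero, sh_zero, conj_pow_apply_of_le_half hc hU k hUa hUa', hAU]
    | succ j =>
      rw [Nat.mul_succ, Nat.add_comm, sh_add, sh_add,
        hU' _ (ha.trans (le_sh _ ha')) (sh_le_one _ ha'),
        ih (by omega) (fun h => hab (by omega)), hA _ (hb.trans (le_sh _ hb')) (sh_le_one _ hb')]

end Conjugation

theorem x0_sh_succ (m : ℕ) {c : ℝ} (h0 : 1 / 2 ≤ c) (h1 : c ≤ 1) :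
    x0 (sh (m + 1) c) = sh m c := by
  rw [x0_of_ge (three_quarters_le_sh_succ m h0 h1) (sh_le_one _ h1), sh_add, two_mul_sh_sub_one]
  congr 1
  unfold sh
  ring

theorem length_conj_lower_bound {A U c : Equiv.Perm ℝ} {q k : ℕ} {e : ℝ} (hq : 1 ≤ q)
    (hc : ∀ t ≤ 1 / 2, c t = t) (hcβ : c (9 / 16) = 3 / 4) (hcγ : c (5 / 8) = 7 / 8)
    (hU : ∀ t, 0 ≤ t → t ≤ 1 / 2 → 0 ≤ U t ∧ U t ≤ 1 / 2 ∧ A (U t) = t)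
    (hU' : ∀ t, 1 / 2 ≤ t → t ≤ 1 → U (sh (q + 1) t) = t)
    (hA : ∀ t, 3 / 4 ≤ t → t ≤ 1 → A t = sh (q + 1) t)
    (hβ : 0 ≤ U (9 / 16) ∧ U (9 / 16) ≤ 1 / 2 ∧ A (U (9 / 16)) = 3 / 4)
    (hγ : 0 ≤ U (5 / 8) ∧ U (5 / 8) ≤ 1 / 2 ∧ A (U (5 / 8)) = 7 / 8)
    (hδ : 0 ≤ U (sh q (1 / 2)) ∧ U (sh q (1 / 2)) ≤ 1 / 2 ∧
      A (U (sh q (1 / 2))) = sh (q + 1) (9 / 16))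
    (hα : A (1 / 2) = sh (q + 1) (5 / 8))
    (he : 1 / 2 < e) (he' : e < sh (q + 1) (1 / 2))
    (hη : 0 ≤ U e ∧ U e ≤ 1 / 2 ∧ A (U e) = sh (q + 1) (1 / 2))
    {w : List (Equiv.Perm ℝ)} (hw : ∀ s ∈ w, s ∈ generators)
    (hf : w.prod = x0 * (A ^ k * c * U ^ k)) : 8 * k + 3 ≤ w.length := by
  have value : ∀ {a d : ℝ}, 1 / 2 ≤ a → a ≤ 1 → 1 / 2 ≤ d → d ≤ 1 →
      (0 ≤ U a ∧ U a ≤ 1 / 2 ∧ A (U a) = sh (q + 1) d) → ∀ j < k,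
      (x0 * (A ^ k * c * U ^ k)) (sh ((q + 1) * j) a) = sh ((q + 1) * j + q) d := by
    rintro a d ha ha' hd hd' ⟨h1, h2, h3⟩ j hj
    rw [Equiv.Perm.mul_apply, conj_pow_apply_sh hc hU hU' hA ha ha'
      (three_quarters_le_sh_succ q hd hd') (sh_le_one _ hd') h1 h2 h3 hj.le (by omega),
      ← sh_add, ← add_assoc, x0_sh_succ _ hd hd']
  refine length_lower_bound (η := fun j => sh ((q + 1) * j) e) hq ?_ ?_ ?_ ?_ ?_ ?_ ?_ hw hf
  · intro j hj
    rw [Equiv.Perm.mul_apply, conj_pow_apply_sh hc hU hU' hA (by norm_num) (by norm_num)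
      le_rfl (by norm_num) hβ.1 hβ.2.1 hβ.2.2 hj (fun _ => hcβ), ← sh_succ_half,
      x0_sh_succ _ le_rfl (by norm_num)]
  · intro j hj
    rw [Equiv.Perm.mul_apply, conj_pow_apply_sh hc hU hU' hA (by norm_num) (by norm_num)
      (by norm_num) (by norm_num) hγ.1 hγ.2.1 hγ.2.2 hj (fun _ => hcγ),
      show (7 / 8 : ℝ) = sh 2 (1 / 2) by norm_num [sh], ← sh_add,
      x0_sh_succ (_ + 1) le_rfl (by norm_num)]
  · intro j hj
    rw [sh_add _ q (1 / 2)]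
    exact value (le_sh _ (by norm_num)) (sh_le_one _ (by norm_num)) (by norm_num) (by norm_num)
      hδ j hj
  · intro j hj
    rw [Nat.mul_succ, sh_add _ (q + 1)]
    have h := hU' (1 / 2) le_rfl (by norm_num)
    refine value (le_sh _ (by norm_num)) (sh_le_one _ (by norm_num)) (by norm_num) (by norm_num)
      ?_ j hj
    rw [h]
    exact ⟨by norm_num, le_rfl, hα⟩
  · exact value he.le (he'.le.trans (sh_le_one _ (by norm_num))) le_rfl (by norm_num) hη
  · intro j _
    exact he.trans_le (le_sh _ (he'.le.trans (sh_le_one _ (by norm_num))))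
  · intro j _
    rw [Nat.mul_succ, sh_add _ (q + 1)]
    exact sh_strictMono _ he'

theorem x1_inv_sq_apply (t : ℝ) : (x1⁻¹ ^ 2) t = x1⁻¹ (x1⁻¹ t) := by
  rw [pow_two]; rfl

theorem x1_inv_sq_of_le_half {t : ℝ} (h : t ≤ 1 / 2) : (x1⁻¹ ^ 2) t = t := by
  rw [x1_inv_sq_apply, x1_inv_of_le_half h, x1_inv_of_le_half h]

theorem x1_inv_sq_of_ge {t : ℝ} (h0 : 3 / 4 ≤ t) (h1 : t ≤ 1) :
    (x1⁻¹ ^ 2) t = (t + 3) / 4 := by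
  rw [x1_inv_sq_apply, x1_inv_of_ge h0 h1, x1_inv_of_ge (by linarith) (by linarith)]
  ring

theorem x1_inv_sq_nine_sixteenths : (x1⁻¹ ^ 2) (9 / 16) = 3 / 4 := by
  rw [x1_inv_sq_apply, x1_inv_of_mid (t := 9 / 16) (by norm_num) (by norm_num),
    x1_inv_of_mid (by norm_num) (by norm_num)]
  norm_num

theorem x1_inv_sq_five_eighths : (x1⁻¹ ^ 2) (5 / 8) = 7 / 8 := by
  rw [x1_inv_sq_apply, x1_inv_of_mid (t := 5 / 8) (by norm_num) (by norm_num),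
    x1_inv_of_ge (by norm_num) (by norm_num)]
  norm_num

theorem fEl_length_lower_bound (k : ℕ) {w : List (Equiv.Perm ℝ)}
    (hw : ∀ s ∈ w, s ∈ generators) (hf : w.prod = fEl (k + 1)) : 8 * k + 3 ≤ w.length := by
  have hA : ∀ t, (x1⁻¹ * x0⁻¹ * x1 * x0⁻¹) t = x1⁻¹ (x0⁻¹ (x1 (x0⁻¹ t))) := fun _ => rfl
  have hU : ∀ t, (x0 * x1 * x0 * x1⁻¹) t = x0 (x1 (x0 (x1⁻¹ t))) := fun _ => rfl
  have hU_low : ∀ t, 0 ≤ t → t ≤ 1 / 2 → (x0 * x1 * x0 * x1⁻¹) t = t / 4 := by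
    intro t h0 h1
    rw [hU, x1_inv_of_le_half h1, x0_of_le_half h0 h1, x1_of_le_half (by linarith),
      x0_of_le_half (by linarith) (by linarith)]
    ring
  have hA_low : ∀ t, 0 ≤ t → t ≤ 1 / 8 → (x1⁻¹ * x0⁻¹ * x1 * x0⁻¹) t = 4 * t := by
    intro t h0 h1
    rw [hA, x0_inv_of_le h0 (by linarith), x1_of_le_half (by linarith),
      x0_inv_of_le (by linarith) (by linarith), x1_inv_of_le_half (by linarith)]
    ring
  have hU9 : (x0 * x1 * x0 * x1⁻¹) (9 / 16) = 3 / 16 := by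
    rw [hU, x1_inv_of_mid (by norm_num) (by norm_num), x0_of_mid (t := 2 * (9 / 16) - 1 / 2)
        (by norm_num) (by norm_num),
      x1_of_le_half (by norm_num), x0_of_le_half (by norm_num) (by norm_num)]
    norm_num
  have hU5 : (x0 * x1 * x0 * x1⁻¹) (5 / 8) = 1 / 4 := by
    rw [hU, x1_inv_of_mid (by norm_num) (by norm_num), x0_of_mid (t := 2 * (5 / 8) - 1 / 2)
        (by norm_num) (by norm_num),
      x1_of_le_half (by norm_num), x0_of_le_half (by norm_num) (by norm_num)]
    norm_num
  have hU3 : (x0 * x1 * x0 * x1⁻¹) (3 / 4) = 3 / 8 := by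
    rw [hU, x1_inv_of_ge (by norm_num) (by norm_num), x0_of_ge (t := (3 / 4 + 1) / 2) (by norm_num) (by norm_num),
      x1_of_mid (by norm_num) (by norm_num), x0_of_mid (by norm_num) (by norm_num)]
    norm_num
  have hA9 : (x1⁻¹ * x0⁻¹ * x1 * x0⁻¹) (3 / 16) = 3 / 4 := by
    rw [hA, x0_inv_of_le (t := 3 / 16) (by norm_num) (by norm_num), x1_of_le_half (by norm_num),
      x0_inv_of_mid (by norm_num) (by norm_num), x1_inv_of_mid (by norm_num) (by norm_num)]
    norm_num
  have hA5 : (x1⁻¹ * x0⁻¹ * x1 * x0⁻¹) (1 / 4) = 7 / 8 := by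
    rw [hA, x0_inv_of_le (t := 1 / 4) (by norm_num) (by norm_num), x1_of_le_half (by norm_num),
      x0_inv_of_mid (by norm_num) (by norm_num), x1_inv_of_ge (by norm_num) (by norm_num)]
    norm_num
  have hA3 : (x1⁻¹ * x0⁻¹ * x1 * x0⁻¹) (3 / 8) = 57 / 64 := by
    rw [hA, x0_inv_of_mid (t := 3 / 8) (by norm_num) (by norm_num), x1_of_mid (by norm_num) (by norm_num),
      x0_inv_of_ge (by norm_num) (by norm_num), x1_inv_of_ge (by norm_num) (by norm_num)]
    norm_num
  have h3 : sh 1 (1 / 2) = 3 / 4 := by norm_num [sh]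
  refine length_conj_lower_bound (A := x1⁻¹ * x0⁻¹ * x1 * x0⁻¹)
    (U := x0 * x1 * x0 * x1⁻¹) (q := 1) (e := 5 / 8) le_rfl (fun t => x1_inv_sq_of_le_half)
    x1_inv_sq_nine_sixteenths x1_inv_sq_five_eighths ?_ ?_ ?_ ?_ ?_ ?_ ?_ (by norm_num)
    (by norm_num [sh]) ?_ hw (hf.trans ?_)
  · intro t h0 h1
    rw [hU_low t h0 h1, hA_low _ (by linarith) (by linarith)]
    exact ⟨by linarith, by linarith, by ring⟩
  · intro t h0 h1
    rw [hU, show sh (1 + 1) t = (t + 3) / 4 by unfold sh; ring,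
      x1_inv_of_ge (by linarith) (by linarith),
      x0_of_ge (t := ((t + 3) / 4 + 1) / 2) (by linarith) (by linarith),
      x1_of_ge (by linarith) (by linarith), x0_of_ge (by linarith) (by linarith)]
    ring
  · intro t h0 h1
    rw [hA, x0_inv_of_ge (t := t) (by linarith) (by linarith), x1_of_ge (by linarith) (by linarith),
      x0_inv_of_ge (by linarith) (by linarith), x1_inv_of_ge (by linarith) (by linarith), sh]
    ring
  · rw [hU9, hA9]; norm_num
  · rw [hU5, hA5]; norm_num
  · rw [h3, hU3, hA3]; norm_num [sh]
  · rw [hA, x0_inv_of_ge (t := 1 / 2) (by norm_num) (by norm_num), x1_of_mid (by norm_num) (by norm_num),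
      x0_inv_of_ge (by norm_num) (by norm_num), x1_inv_of_ge (by norm_num) (by norm_num), sh]
    norm_num
  · rw [hU5, hA5]; norm_num [sh]
  · simp only [fEl, Nat.add_sub_cancel, mul_assoc]

theorem gEl_length_lower_bound (k : ℕ) {w : List (Equiv.Perm ℝ)}
    (hw : ∀ s ∈ w, s ∈ generators) (hf : w.prod = gEl (k + 1)) : 8 * k + 3 ≤ w.length := by
  have hA : ∀ t, (x1⁻¹ ^ 2 * x0⁻¹ * x1 * x0⁻¹) t = (x1⁻¹ ^ 2) (x0⁻¹ (x1 (x0⁻¹ t))) :=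
    fun _ => rfl
  have hU : ∀ t, (x0 * x1 * x0) t = x0 (x1 (x0 t)) := fun _ => rfl
  have hU_mid : ∀ t, 1 / 2 ≤ t → t ≤ 3 / 4 → (x0 * x1 * x0) t = t / 2 - 1 / 8 := by
    intro t h0 h1
    rw [hU, x0_of_mid h0 h1, x1_of_le_half (by linarith),
      x0_of_le_half (by linarith) (by linarith)]
    ring
  have hU_low : ∀ t, 0 ≤ t → t ≤ 1 / 2 → (x0 * x1 * x0) t = t / 4 := by
    intro t h0 h1
    rw [hU, x0_of_le_half h0 h1, x1_of_le_half (by linarith),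
      x0_of_le_half (by linarith) (by linarith)]
    ring
  have hU7 : (x0 * x1 * x0) (7 / 8) = 3 / 8 := by
    rw [hU, x0_of_ge (t := 7 / 8) (by norm_num) (by norm_num), x1_of_mid (by norm_num) (by norm_num),
      x0_of_mid (by norm_num) (by norm_num)]
    norm_num
  have hA_low : ∀ t, 0 ≤ t → t ≤ 1 / 8 → (x1⁻¹ ^ 2 * x0⁻¹ * x1 * x0⁻¹) t = 4 * t := by
    intro t h0 h1
    rw [hA, x0_inv_of_le h0 (by linarith), x1_of_le_half (by linarith),
      x0_inv_of_le (by linarith) (by linarith), x1_inv_sq_of_le_half (by linarith)]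
    ring
  have hA_mid : ∀ t, 1 / 8 ≤ t → t ≤ 1 / 4 →
      (x1⁻¹ ^ 2 * x0⁻¹ * x1 * x0⁻¹) t = (x1⁻¹ ^ 2) (2 * t + 1 / 4) := by
    intro t h0 h1
    rw [hA, x0_inv_of_le (by linarith) h1, x1_of_le_half (by linarith),
      x0_inv_of_mid (by linarith) (by linarith)]
  have hA_three_eighths : (x1⁻¹ ^ 2 * x0⁻¹ * x1 * x0⁻¹) (3 / 8) = 121 / 128 := by
    rw [hA, x0_inv_of_mid (t := 3 / 8) (by norm_num) (by norm_num), x1_of_mid (by norm_num) (by norm_num),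
      x0_inv_of_ge (by norm_num) (by norm_num), x1_inv_sq_of_ge (by norm_num) (by norm_num)]
    norm_num
  have h7 : sh 2 (1 / 2) = 7 / 8 := by norm_num [sh]
  refine length_conj_lower_bound (A := x1⁻¹ ^ 2 * x0⁻¹ * x1 * x0⁻¹)
    (U := x0 * x1 * x0) (q := 2) (e := 3 / 4) one_le_two
    (fun t => x1_inv_sq_of_le_half) x1_inv_sq_nine_sixteenths x1_inv_sq_five_eighths
    ?_ ?_ ?_ ?_ ?_ ?_ ?_ (by norm_num) (by norm_num [sh]) ?_ hw (hf.trans ?_)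
  · intro t h0 h1
    rw [hU_low t h0 h1, hA_low _ (by linarith) (by linarith)]
    exact ⟨by linarith, by linarith, by ring⟩
  · intro t h0 h1
    rw [hU, show sh (2 + 1) t = (t + 7) / 8 by unfold sh; ring,
      x0_of_ge (t := (t + 7) / 8) (by linarith) (by linarith), x1_of_ge (by linarith) (by linarith),
      x0_of_ge (by linarith) (by linarith)]
    ring
  · intro t h0 h1
    rw [hA, x0_inv_of_ge (t := t) (by linarith) (by linarith), x1_of_ge (by linarith) (by linarith),
      x0_inv_of_ge (by linarith) (by linarith), x1_inv_sq_of_ge (by linarith) (by linarith), sh]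
    ring
  · rw [hU_mid _ (by norm_num) (by norm_num), hA_mid _ (by norm_num) (by norm_num),
      show (2 * (9 / 16 / 2 - 1 / 8) + 1 / 4 : ℝ) = 9 / 16 by norm_num,
      x1_inv_sq_nine_sixteenths]
    norm_num
  · rw [hU_mid _ (by norm_num) (by norm_num), hA_mid _ (by norm_num) (by norm_num),
      show (2 * (5 / 8 / 2 - 1 / 8) + 1 / 4 : ℝ) = 5 / 8 by norm_num, x1_inv_sq_five_eighths]
    norm_num
  · rw [h7, hU7, hA_three_eighths]; norm_num [sh]
  · rw [hA, x0_inv_of_ge (t := 1 / 2) (by norm_num) (by norm_num), x1_of_mid (by norm_num) (by norm_num),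
      x0_inv_of_ge (by norm_num) (by norm_num), x1_inv_sq_of_ge (by norm_num) (by norm_num), sh]
    norm_num
  · rw [hU_mid _ (by norm_num) le_rfl, hA_mid _ (by norm_num) (by norm_num), x1_inv_sq_of_ge (by norm_num) (by norm_num)]
    norm_num [sh]
  · simp only [gEl, Nat.add_sub_cancel, mul_assoc]

/-! ### The word length -/

theorem wordLength_eq {f : Equiv.Perm ℝ} (w : List (Equiv.Perm ℝ))
    (hw : ∀ s ∈ w, s ∈ generators) (hf : w.prod = f)
    (hmin : ∀ v : List (Equiv.Perm ℝ), (∀ s ∈ v, s ∈ generators) → v.prod = f →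
      w.length ≤ v.length) : wordLength f = w.length := by
  refine le_antisymm (Nat.sInf_le ⟨w, rfl, hw, hf⟩) (le_csInf ⟨_, w, rfl, hw, hf⟩ ?_)
  rintro _ ⟨v, rfl, hv, hvf⟩
  exact hmin v hv hvf

theorem wordLength_fEl (k : ℕ) : wordLength (fEl (k + 1)) = 8 * k + 3 := by
  let w : List (Equiv.Perm ℝ) :=
    [x0] ++ (List.replicate k [x1⁻¹, x0⁻¹, x1, x0⁻¹]).flatten ++ [x1⁻¹, x1⁻¹] ++
      (List.replicate k [x0, x1, x0, x1⁻¹]).flatten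
  have hlen : w.length = 8 * k + 3 := by simp [w]; ring
  rw [← hlen]
  refine wordLength_eq w ?_ ?_ fun v hv hvf => hlen ▸ fEl_length_lower_bound k hv hvf
  · simp only [w, List.mem_append, List.mem_flatten, List.mem_replicate, List.mem_cons,
      List.not_mem_nil, or_false]
    rintro s (((rfl | ⟨l, ⟨-, rfl⟩, hs⟩) | rfl | rfl) | ⟨l, ⟨-, rfl⟩, hs⟩)
    all_goals simp_all [generators]
    all_goals tauto
  · simp [w, fEl, List.prod_flatten, pow_two, mul_assoc]

theorem wordLength_gEl (k : ℕ) : wordLength (gEl (k + 1)) = 8 * k + 3 := by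
  let w : List (Equiv.Perm ℝ) :=
    [x0] ++ (List.replicate k [x1⁻¹, x1⁻¹, x0⁻¹, x1, x0⁻¹]).flatten ++ [x1⁻¹, x1⁻¹] ++
      (List.replicate k [x0, x1, x0]).flatten
  have hlen : w.length = 8 * k + 3 := by simp [w]; ring
  rw [← hlen]
  refine wordLength_eq w ?_ ?_ fun v hv hvf => hlen ▸ gEl_length_lower_bound k hv hvf
  · simp only [w, List.mem_append, List.mem_flatten, List.mem_replicate, List.mem_cons,
      List.not_mem_nil, or_false]
    rintro s (((rfl | ⟨l, ⟨-, rfl⟩, hs⟩) | rfl | rfl) | ⟨l, ⟨-, rfl⟩, hs⟩)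
    all_goals simp_all [generators]
    all_goals tauto
  · simp [w, gEl, List.prod_flatten, pow_two, mul_assoc]

theorem fn_gn_length_exact (n : ℕ) (hn : 3 ≤ n) :
    wordLength (fEl n) = 8 * n - 5 ∧ wordLength (gEl n) = 8 * n - 5 := by
  obtain ⟨k, rfl⟩ := Nat.exists_eq_add_of_le' (show 1 ≤ n by omega)
  exact ⟨by rw [wordLength_fEl]; omega, by rw [wordLength_gEl]; omega⟩

end
end
end

section
/- Let f : [0,1] → [0,1] be a strictly increasing bijection with f(t) > t for all t ∈ (0,1), and let k : [0,1] → [0,1] be a bijection with k ∘ f = f ∘ k. If there exists ε > 0 such that k is strictly increasing on the interval (1−ε, 1), then k is strictly increasing on all of (0,1). -/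
noncomputable section

open Set


/-- The supremum of an orbit of a strictly increasing surjection is not moved upwards. -/
theorem StrictMono.apply_le_of_isLUB_orbit {α : Type*} [LinearOrder α] {f : α → α}
    (hf : StrictMono f) (hsurj : Function.Surjective f) {x c : α}
    (hc : IsLUB (Set.range fun n : ℕ => f^[n] x) c) : f c ≤ c := by
  by_contra! hlt
  obtain ⟨b, rfl⟩ := hsurj c
  obtain ⟨_, ⟨n, rfl⟩, hn⟩ := (lt_isLUB_iff hc).1 (hf.lt_iff_lt.1 hlt)
  have hle : f^[n + 1] x ≤ f b := hc.1 ⟨n + 1, rfl⟩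
  rw [Function.iterate_succ_apply'] at hle
  exact (hf hn).not_ge hle

/-- If a strictly increasing bijection of `[0,1]` moves every interior point to the right,
then orbits of positive points come arbitrarily close to `1`. -/
theorem exists_lt_iterate_of_lt_apply {f : Set.Icc (0:ℝ) 1 → Set.Icc (0:ℝ) 1}
    (hf : StrictMono f) (hsurj : Function.Surjective f)
    (hgt : ∀ t : Set.Icc (0:ℝ) 1, 0 < (t : ℝ) → (t : ℝ) < 1 → (t : ℝ) < (f t : ℝ))
    {x : Set.Icc (0:ℝ) 1} (hx : 0 < (x : ℝ)) {a : ℝ} (ha : a < 1) :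
    ∃ n : ℕ, a < (f^[n] x : ℝ) := by
  have hc := isLUB_csSup (Set.range_nonempty fun n : ℕ => f^[n] x)
    (OrderTop.bddAbove _)
  set c := sSup (Set.range fun n : ℕ => f^[n] x)
  have hxc : x ≤ c := hc.1 ⟨0, rfl⟩
  have hc_one : 1 ≤ (c : ℝ) := by
    by_contra! hlt
    exact (hf.apply_le_of_isLUB_orbit hsurj hc).not_gt (hgt c (hx.trans_le hxc) hlt)
  let b : Set.Icc (0:ℝ) 1 := ⟨max a 0, le_max_right _ _, max_le ha.le zero_le_one⟩
  have hb : b < c := Subtype.coe_lt_coe.1 ((max_lt ha zero_lt_one).trans_le hc_one)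
  obtain ⟨_, ⟨n, rfl⟩, hn⟩ := (lt_isLUB_iff hc).1 hb
  exact ⟨n, (le_max_left a 0).trans_lt (Subtype.coe_lt_coe.2 hn)⟩

theorem strictMono_of_commuting_with_expansive
    (f k : Set.Icc (0:ℝ) 1 → Set.Icc (0:ℝ) 1)
    (hf_mono : StrictMono f) (hf_bij : Function.Bijective f)
    (hf_gt : ∀ t : Set.Icc (0:ℝ) 1, 0 < (t : ℝ) → (t : ℝ) < 1 → (t : ℝ) < (f t : ℝ))
    (hk_bij : Function.Bijective k)
    (hcomm : k ∘ f = f ∘ k)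
    (ε : ℝ) (hε : 0 < ε)
    (hk_inc : StrictMonoOn k {t : Set.Icc (0:ℝ) 1 | 1 - ε < (t : ℝ) ∧ (t : ℝ) < 1}) :
    StrictMonoOn k {t : Set.Icc (0:ℝ) 1 | 0 < (t : ℝ) ∧ (t : ℝ) < 1} := by
  rintro x ⟨hx0, -⟩ y ⟨-, hy1⟩ hxy
  obtain ⟨n, hn⟩ := exists_lt_iterate_of_lt_apply hf_mono hf_bij.2 hf_gt hx0
    (sub_lt_self 1 hε)
  have hfn : StrictMono f^[n] := hf_mono.iterate n
  have hy_lt : (f^[n] y : ℝ) < 1 :=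
    (Subtype.coe_lt_coe.2 (hfn (show y < 1 from hy1))).trans_le (f^[n] 1).2.2
  have hxy_lt : (f^[n] x : ℝ) < f^[n] y := hfn hxy
  have hk := hk_inc ⟨hn, hxy_lt.trans hy_lt⟩ ⟨hn.trans hxy_lt, hy_lt⟩ (hfn hxy)
  have hkf : Function.Commute k f := congrFun hcomm
  rwa [hkf.iterate_right n x, hkf.iterate_right n y, hfn.lt_iff_lt] at hk

end
end
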